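/- arXiv:2210.00459 — 9 statements merged into one kernel-verified Lean document; each statement's English description precedes it below -/
import Mathlib

section
/- The group of all self-homeomorphisms of the Cantor space is boundedly acyclic: for every n ≥ 1, every G-invariant bounded function f : G^{n+1} → ℝ satisfying δⁿ f = 0 is of the form δ^{n−1} h for some G-invariant bounded function h : Gⁿ → ℝ, where G = Homeo(K) and K = ℕ → Bool with the product topology. -/
/-- The Cantor space `ℕ → Bool` with the product topology (each factor discrete). -/
abbrev CantorSpace : Type := ℕ → Bool

/-- The group of self-homeomorphisms of a topological space,
with multiplication given by composition: `(f * g) x = f (g x)`. -/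
instance homeoGroup (X : Type*) [TopologicalSpace X] : Group (Homeomorph X X) where
  mul f g := g.trans f
  one := Homeomorph.refl X
  inv := Homeomorph.symm
  mul_assoc f g h := Homeomorph.ext fun _ => rfl
  one_mul f := Homeomorph.ext fun _ => rfl
  mul_one f := Homeomorph.ext fun _ => rfl
  inv_mul_cancel f := Homeomorph.ext fun x => f.symm_apply_apply x

/-- A real-valued function is bounded. -/
def BddFn {α : Type*} (f : α → ℝ) : Prop := ∃ C : ℝ, ∀ x, |f x| ≤ C

/-- `G`-invariance of a cochain under the diagonal action
`(g · f)(g₀, …, gₙ) = f(g⁻¹g₀, …, g⁻¹gₙ)`. -/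
def GInvariant (G : Type*) [Group G] {n : ℕ} (f : (Fin n → G) → ℝ) : Prop :=
  ∀ (g : G) (x : Fin n → G), f (fun i => g * x i) = f x

/-- The simplicial coboundary
`δⁿ f (g₀, …, g_{n+1}) = ∑ i, (-1)^i f(g₀, …, ĝᵢ, …, g_{n+1})`. -/
def coboundary {G : Type*} (n : ℕ) (f : (Fin (n + 1) → G) → ℝ) :
    (Fin (n + 2) → G) → ℝ :=
  fun x => ∑ i : Fin (n + 2), (-1 : ℝ) ^ (i : ℕ) * f (x ∘ i.succAbove)

/-- `G` is boundedly acyclic: for every `n ≥ 1` (written `n = m + 1` below), every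
`G`-invariant bounded function `f : G^{n+1} → ℝ` with `δⁿ f = 0` equals `δ^{n-1} h`
for some `G`-invariant bounded `h : Gⁿ → ℝ`. -/
def BoundedlyAcyclic (G : Type*) [Group G] : Prop :=
  ∀ (m : ℕ) (f : (Fin (m + 2) → G) → ℝ),
    BddFn f → GInvariant G f → coboundary (m + 1) f = 0 →
    ∃ h : (Fin (m + 1) → G) → ℝ, BddFn h ∧ GInvariant G h ∧ coboundary m h = f


namespace HC
open Filter Topology

/-! ### Cochain algebra -/

/-- The simplicial coboundary, on functions of `n` variables. -/
def cD {X : Type*} {n : ℕ} (f : (Fin n → X) → ℝ) : (Fin (n + 1) → X) → ℝ :=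
  fun x => ∑ i : Fin (n + 1), (-1 : ℝ) ^ (i : ℕ) * f (x ∘ i.succAbove)

theorem cD_zero {X : Type*} {n : ℕ} : cD (fun _ : Fin n → X => (0 : ℝ)) = fun _ => 0 := by
  funext x; simp [cD]

theorem cD_add {X : Type*} {n : ℕ} (f g : (Fin n → X) → ℝ) (x : Fin (n + 1) → X) :
    cD (fun z => f z + g z) x = cD f x + cD g x := by
  simp [cD, mul_add, Finset.sum_add_distrib]

theorem cD_sub {X : Type*} {n : ℕ} (f g : (Fin n → X) → ℝ) (x : Fin (n + 1) → X) :
    cD (fun z => f z - g z) x = cD f x - cD g x := by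
  simp [cD, mul_sub, Finset.sum_sub_distrib]

theorem cD_neg {X : Type*} {n : ℕ} (f : (Fin n → X) → ℝ) (x : Fin (n + 1) → X) :
    cD (fun z => - f z) x = - cD f x := by
  simp [cD]

theorem cD_comp {X Y : Type*} {n : ℕ} (f : (Fin n → X) → ℝ) (ψ : Y → X) (y : Fin (n + 1) → Y) :
    cD (fun z => f (ψ ∘ z)) y = cD f (ψ ∘ y) := rfl

theorem cons_succAbove_succ {X : Type*} {n : ℕ} (a : X) (x : Fin (n + 1) → X) (i : Fin (n + 1)) :
    (Fin.cons a x : Fin (n + 2) → X) ∘ (i.succ).succAbove = Fin.cons a (x ∘ i.succAbove) := by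
  funext j
  refine Fin.cases ?_ (fun j => ?_) j
  · simp
  · simp

theorem cD_cons {X : Type*} {n : ℕ} (f : (Fin (n + 1) → X) → ℝ) (a : X) (x : Fin (n + 1) → X) :
    cD f (Fin.cons a x) = f x - cD (fun z => f (Fin.cons a z)) x := by
  unfold cD
  rw [Fin.sum_univ_succ]
  have h0 : (Fin.cons a x : Fin (n + 2) → X) ∘ (0 : Fin (n + 2)).succAbove = x := by
    funext j; simp
  rw [h0]
  simp only [cons_succAbove_succ, Fin.val_zero, pow_zero, one_mul, Fin.val_succ, pow_succ]
  rw [sub_eq_add_neg, ← Finset.sum_neg_distrib]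
  congr 1
  refine Finset.sum_congr rfl fun i _ => ?_
  ring

/-- Alternating sum of `n` ones. -/
def eps (n : ℕ) : ℝ := ∑ i : Fin n, (-1 : ℝ) ^ (i : ℕ)

theorem eps_succ (n : ℕ) : eps (n + 1) = 1 - eps n := by
  unfold eps
  rw [Fin.sum_univ_succ]
  simp [pow_succ, sub_eq_add_neg]

theorem cD_const {X : Type*} {n : ℕ} (c : ℝ) (x : Fin (n + 1) → X) :
    cD (fun _ : Fin n → X => c) x = eps (n + 1) * c := by
  simp [cD, eps, Finset.sum_mul]

theorem cD_cD {X : Type*} {n : ℕ} (f : (Fin n → X) → ℝ) : cD (cD f) = fun _ => 0 := by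
  induction n with
  | zero =>
    funext x
    have h : ∀ u : Fin 0 → X, f u = f Fin.elim0 := fun u => by
      rw [Subsingleton.elim u Fin.elim0]
    have e : f = fun _ => f Fin.elim0 := funext h
    have e1 : cD f = fun _ => eps 1 * f Fin.elim0 := by
      funext z; rw [e, cD_const]
    rw [e1, cD_const]
    have h0 : eps 0 = 0 := by simp [eps]
    simp [eps_succ, h0]
  | succ n ih =>
    funext x
    obtain ⟨a, z, rfl⟩ : ∃ a z, x = Fin.cons a z := ⟨x 0, Fin.tail x, (Fin.cons_self_tail x).symm⟩
    rw [cD_cons]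
    have : (fun z => cD f (Fin.cons a z)) = fun z => f z - cD (fun z => f (Fin.cons a z)) z := by
      funext z; rw [cD_cons]
    rw [this, cD_sub, ih]; simp

theorem cD_cone {X : Type*} {n : ℕ} (f : (Fin (n + 1) → X) → ℝ) (hf : cD f = fun _ => 0) (a : X)
    (x : Fin (n + 1) → X) : cD (fun z => f (Fin.cons a z)) x = f x := by
  have := cD_cons f a x
  rw [hf] at this; linarith

/-! ### The prism operator -/

/-- Prism operator. -/
def prism {Y Z : Type*} (φ ψ : Y → Z) : (n : ℕ) → ((Fin (n + 1) → Z) → ℝ) → (Fin n → Y) → ℝ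
  | 0, _, _ => 0
  | n + 1, f, y => f (Fin.cons (φ (y 0)) (Fin.cons (ψ (y 0)) (ψ ∘ Fin.tail y)))
      - prism φ ψ n (fun z => f (Fin.cons (φ (y 0)) z)) (Fin.tail y)

theorem prism_sub {Y Z : Type*} (φ ψ : Y → Z) (n : ℕ) (f g : (Fin (n + 1) → Z) → ℝ) (y : Fin n → Y) :
    prism φ ψ n (fun z => f z - g z) y = prism φ ψ n f y - prism φ ψ n g y := by
  induction n with
  | zero => simp [prism]
  | succ n ih => simp only [prism, ih]; ring

theorem prism_bd {Y Z : Type*} (φ ψ : Y → Z) (n : ℕ) (f : (Fin (n + 1) → Z) → ℝ) (C : ℝ)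
    (hf : ∀ z, |f z| ≤ C) (y : Fin n → Y) : |prism φ ψ n f y| ≤ n * C := by
  induction n with
  | zero => simp [prism]
  | succ n ih =>
    simp only [prism]
    refine (abs_sub _ _).trans ?_
    have := ih (fun z => f (Fin.cons (φ (y 0)) z)) (fun z => hf _) (Fin.tail y)
    have := hf (Fin.cons (φ (y 0)) (Fin.cons (ψ (y 0)) (ψ ∘ Fin.tail y)))
    push_cast; linarith

theorem comp_cons {Y Z : Type*} {n : ℕ} (τ : Y → Z) (a : Y) (z : Fin n → Y) :
    τ ∘ (Fin.cons a z : Fin (n + 1) → Y) = Fin.cons (τ a) (τ ∘ z) := by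
  funext j
  refine Fin.cases ?_ (fun j => ?_) j <;> simp

theorem prism_equiv {Y Z : Type*} (φ ψ : Y → Z) (σ : Y → Y) (τ : Z → Z)
    (hφ : ∀ y, φ (σ y) = τ (φ y)) (hψ : ∀ y, ψ (σ y) = τ (ψ y))
    (n : ℕ) (f : (Fin (n + 1) → Z) → ℝ) (y : Fin n → Y) :
    prism φ ψ n f (σ ∘ y) = prism φ ψ n (fun z => f (τ ∘ z)) y := by
  induction n with
  | zero => simp [prism]
  | succ n ih =>
    simp only [prism, comp_cons, Function.comp_apply, hφ, hψ]
    have h1 : Fin.tail (σ ∘ y) = σ ∘ Fin.tail y := rfl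
    have h2 : ψ ∘ (σ ∘ Fin.tail y) = τ ∘ (ψ ∘ Fin.tail y) := by funext j; simp [hψ]
    rw [h1, h2, ih]

theorem prism_eq {Y Z : Type*} (φ ψ : Y → Z) (n : ℕ) (f : (Fin (n + 1) → Z) → ℝ)
    (y : Fin (n + 1) → Y) :
    cD (prism φ ψ n f) y + prism φ ψ (n + 1) (cD f) y = f (ψ ∘ y) - f (φ ∘ y) := by
  induction n with
  | zero =>
    have h : prism φ ψ 0 f = fun _ => 0 := by funext; rfl
    rw [h, cD_zero]
    simp only [prism, cD_cons]
    have e : ∀ (g : (Fin 0 → Z) → ℝ) (x : Fin 1 → Z), cD g x = g Fin.elim0 := by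
      intro g x
      simp only [cD, Finset.univ_unique, Finset.sum_singleton]
      simp
      congr 1
      exact Subsingleton.elim _ _
    rw [e]
    have e1 : (Fin.cons (ψ (y 0)) (ψ ∘ Fin.tail y) : Fin 1 → Z) = ψ ∘ y := by
      rw [← comp_cons, Fin.cons_self_tail]
    have e2 : (Fin.cons (φ (y 0)) Fin.elim0 : Fin 1 → Z) = φ ∘ y := by
      funext j; fin_cases j; rfl
    rw [e1, e2]; ring
  | succ n ih =>
    obtain ⟨a, z, rfl⟩ : ∃ a z, y = Fin.cons a z := ⟨y 0, Fin.tail y, (Fin.cons_self_tail y).symm⟩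
    rw [cD_cons]
    have e1 : (fun z' => prism φ ψ (n + 1) f (Fin.cons a z')) = fun z' =>
        f (Fin.cons (φ a) (Fin.cons (ψ a) (ψ ∘ z')))
          - prism φ ψ n (fun w => f (Fin.cons (φ a) w)) z' := by
      funext z'; simp [prism]
    rw [e1, cD_sub]
    have e2 : prism φ ψ (n + 2) (cD f) (Fin.cons a z) =
        cD f (Fin.cons (φ a) (Fin.cons (ψ a) (ψ ∘ z)))
          - prism φ ψ (n + 1) (fun w => cD f (Fin.cons (φ a) w)) z := by
      simp [prism]
    have e3 : (fun w => cD f (Fin.cons (φ a) w)) =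
        fun w => f w - cD (fun w => f (Fin.cons (φ a) w)) w := by
      funext w; rw [cD_cons]
    rw [e2, e3, prism_sub, cD_cons, cD_cons]
    have := ih (fun w => f (Fin.cons (φ a) w)) z
    have e4 := cD_comp (fun w => f (Fin.cons (φ a) (Fin.cons (ψ a) w))) ψ z
    rw [e4, comp_cons, comp_cons]
    linarith

/-! ### Families of cochains -/

/-- Uniformly bounded family of cochains. -/
def Bd {T Y : Type} {n : ℕ} (F : T → (Fin n → Y) → ℝ) : Prop := ∃ C : ℝ, ∀ t y, |F t y| ≤ C

/-- Invariance under a family of self-maps. -/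
def InvF {R T Y : Type} {n : ℕ} (σ : R → Y → Y) (F : T → (Fin n → Y) → ℝ) : Prop :=
  ∀ r t y, F t (σ r ∘ y) = F t y

/-- `F` is the coboundary of a bounded invariant family. -/
def Cob {R T Y : Type} {n : ℕ} (σ : R → Y → Y) (F : T → (Fin (n + 1) → Y) → ℝ) : Prop :=
  ∃ h : T → (Fin n → Y) → ℝ, Bd h ∧ InvF σ h ∧ ∀ t, cD (h t) = F t

/-- Vanishing of (uniform) bounded cohomology in degree `m + 1`. -/
def Ex {R Y : Type} (σ : R → Y → Y) (m : ℕ) : Prop :=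
  ∀ (T : Type) (F : T → (Fin (m + 2) → Y) → ℝ), Bd F → InvF σ F → (∀ t, cD (F t) = fun _ => 0) →
    Cob σ F

theorem Cob.add {R T Y : Type} {n : ℕ} {σ : R → Y → Y} {F F' : T → (Fin (n + 1) → Y) → ℝ}
    (h : Cob σ F) (h' : Cob σ F') : Cob σ (fun t y => F t y + F' t y) := by
  obtain ⟨u, ⟨C, hC⟩, hi, hd⟩ := h
  obtain ⟨u', ⟨C', hC'⟩, hi', hd'⟩ := h'
  refine ⟨fun t y => u t y + u' t y, ⟨C + C', fun t y => ?_⟩, fun r t y => ?_, fun t => ?_⟩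
  · exact (abs_add_le _ _).trans (add_le_add (hC t y) (hC' t y))
  · simp only [hi r t y, hi' r t y]
  · funext y; rw [cD_add, hd, hd']

theorem Cob.neg {R T Y : Type} {n : ℕ} {σ : R → Y → Y} {F : T → (Fin (n + 1) → Y) → ℝ}
    (h : Cob σ F) : Cob σ (fun t y => - F t y) := by
  obtain ⟨u, ⟨C, hC⟩, hi, hd⟩ := h
  refine ⟨fun t y => - u t y, ⟨C, fun t y => ?_⟩, fun r t y => ?_, fun t => ?_⟩
  · rw [abs_neg]; exact hC t y
  · simp only [hi r t y]
  · funext y; rw [cD_neg, hd]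

theorem Cob.pull {R R' T Y Z : Type} {n : ℕ} {σ : R → Y → Y} {τ : R' → Z → Z}
    {F : T → (Fin (n + 1) → Z) → ℝ} (h : Cob τ F) (φ : Y → Z) (j : R → R')
    (hφ : ∀ r y, φ (σ r y) = τ (j r) (φ y)) : Cob σ (fun t y => F t (φ ∘ y)) := by
  obtain ⟨u, ⟨C, hC⟩, hi, hd⟩ := h
  refine ⟨fun t y => u t (φ ∘ y), ⟨C, fun t y => hC _ _⟩, fun r t y => ?_, fun t => ?_⟩
  · show u t _ = u t _
    rw [← hi (j r) t (φ ∘ y)]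
    congr 1; funext i; simp [hφ]
  · funext y; rw [cD_comp, hd]

theorem Cob.ofPrism {R R' T Y Z : Type} {n : ℕ} {σ : R → Y → Y} {τ : R' → Z → Z}
    {F : T → (Fin (n + 1) → Z) → ℝ} (hb : Bd F) (hF : InvF τ F) (hc : ∀ t, cD (F t) = fun _ => 0)
    (φ ψ : Y → Z) (j : R → R')
    (hφ : ∀ r y, φ (σ r y) = τ (j r) (φ y)) (hψ : ∀ r y, ψ (σ r y) = τ (j r) (ψ y)) :
    Cob σ (fun t y => F t (ψ ∘ y) - F t (φ ∘ y)) := by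
  obtain ⟨C, hC⟩ := hb
  refine ⟨fun t => prism φ ψ n (F t), ⟨n * C, fun t y => ?_⟩, fun r t y => ?_, fun t => ?_⟩
  · exact prism_bd φ ψ n (F t) C (hC t) y
  · show prism φ ψ n (F t) _ = _
    rw [prism_equiv φ ψ (σ r) (τ (j r)) (hφ r) (hψ r)]
    have : (fun z => F t (τ (j r) ∘ z)) = F t := by funext z; exact hF (j r) t z
    rw [this]
  · funext y
    have := prism_eq φ ψ n (F t) y
    rw [hc] at this
    have z : prism φ ψ (n + 1) (fun _ => 0) y = 0 := by
      have := prism_sub φ ψ (n + 1) (fun _ => 0) (fun _ => 0) y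
      simpa using this
    linarith

/-- From `ψ` back to `φ`. -/
theorem Cob.transfer {R R' T Y Z : Type} {n : ℕ} {σ : R → Y → Y} {τ : R' → Z → Z}
    {F : T → (Fin (n + 1) → Z) → ℝ} (hb : Bd F) (hF : InvF τ F) (hc : ∀ t, cD (F t) = fun _ => 0)
    (φ ψ : Y → Z) (j : R → R')
    (hφ : ∀ r y, φ (σ r y) = τ (j r) (φ y)) (hψ : ∀ r y, ψ (σ r y) = τ (j r) (ψ y))
    (h : Cob σ (fun t y => F t (φ ∘ y))) : Cob σ (fun t y => F t (ψ ∘ y)) := by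
  have := (Cob.ofPrism hb hF hc φ ψ j hφ hψ).add h
  simpa using this

/-- A constant cocycle is a coboundary. -/
theorem Cob.const {R T Y : Type} {n : ℕ} (σ : R → Y → Y) [Nonempty Y] (F : T → ℝ)
    (hb : ∃ C, ∀ t, |F t| ≤ C)
    (hc : ∀ t, cD (fun _ : Fin (n + 1) → Y => F t) = fun _ => 0) :
    Cob σ (fun t (_ : Fin (n + 1) → Y) => F t) := by
  obtain ⟨C, hC⟩ := hb
  refine ⟨fun t _ => F t, ⟨C, fun t _ => hC t⟩, fun _ _ _ => rfl, fun t => ?_⟩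
  funext y
  have := congrFun (hc t) (fun _ => Classical.arbitrary Y)
  rw [cD_const, eps_succ] at this
  rw [cD_const]; linarith

/-! ### Ultralimits -/

theorem ulim_exists {X : Type*} (U : Ultrafilter X) (u : X → ℝ) (C : ℝ) (h : ∀ x, |u x| ≤ C) :
    Tendsto u U (𝓝 (limUnder (U : Filter X) u)) := by
  have hc : IsCompact (Set.Icc (-C) C) := isCompact_Icc
  have : ∃ a ∈ Set.Icc (-C) C, (U.map u : Filter ℝ) ≤ 𝓝 a := by
    apply hc.ultrafilter_le_nhds
    simp only [le_principal_iff]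
    refine Filter.mem_map.2 (Filter.univ_mem' fun x => ?_)
    exact abs_le.1 (h x)
  obtain ⟨a, _, ha⟩ := this
  exact tendsto_nhds_limUnder ⟨a, ha⟩

theorem ulim_bd {X : Type*} (U : Ultrafilter X) (u : X → ℝ) (C : ℝ) (h : ∀ x, |u x| ≤ C) :
    |limUnder (U : Filter X) u| ≤ C := by
  have h1 := (ulim_exists U u C h).abs
  exact le_of_tendsto h1 (Eventually.of_forall h)

end HC

namespace HC
open Filter Topology

/-! ### The double complex argument -/

theorem zigzag {M : ℕ → ℕ → Type*} [∀ p q, AddCommGroup (M p q)]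
    (dh : ∀ p q, M p q →+ M (p + 1) q) (dv : ∀ p q, M p q →+ M p (q + 1))
    (hcomm : ∀ p q a, dh p (q + 1) (dv p q a) = dv (p + 1) q (dh p q a))
    (hhh : ∀ p q a, dh (p + 1) q (dh p q a) = 0) (hvv : ∀ p q a, dv p (q + 1) (dv p q a) = 0)
    (A B : ∀ p q, AddSubgroup (M p q)) (hAB : ∀ p q, A p q ≤ B p q)
    (hAh : ∀ p q a, a ∈ A p q → dh p q a ∈ A (p + 1) q)
    (hAv : ∀ p q a, a ∈ A p q → dv p q a ∈ A p (q + 1))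
    (hBh : ∀ p q a, a ∈ B p q → dh p q a ∈ B (p + 1) q)
    (rowInj : ∀ q a, a ∈ A 0 q → dh 0 q a = 0 → a = 0)
    (rowEx : ∀ p q a, a ∈ A (p + 1) q → dh (p + 1) q a = 0 → ∃ b ∈ A p q, dh p q b = a)
    (m : ℕ)
    (colA : ∀ p q, q < m → ∀ a, a ∈ A (p + 1) (q + 1) → dv (p + 1) (q + 1) a = 0 →
      ∃ c ∈ A (p + 1) q, dv (p + 1) q c = a)
    (colB : ∀ p q, ∀ a, a ∈ B (p + 1) (q + 1) → dv (p + 1) (q + 1) a = 0 →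
      ∃ c ∈ B (p + 1) q, dv (p + 1) q c = a)
    (bot : ∀ p z, z ∈ B (p + 1) 0 → dv (p + 1) 0 z = 0 → dh (p + 1) 0 z ∈ A (p + 2) 0 →
      ∃ z' ∈ A (p + 1) 0, dv (p + 1) 0 z' = 0 ∧ dh (p + 1) 0 z' = dh (p + 1) 0 z)
    (f : M 0 (m + 1)) (hf : f ∈ A 0 (m + 1))
    (hu : ∃ u ∈ B 0 m, dv 0 m u = f)
    (h1 : ∃ a ∈ A 1 m, dv 1 m a = dh 0 (m + 1) f) :
    ∃ b ∈ A 0 m, dv 0 m b = f := by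
  have L : ∀ q, q ≤ m → ∀ p a, a ∈ A (p + 1) q → ∀ e, e ∈ B p q →
      dv (p + 1) q (a - dh p q e) = 0 → ∃ b ∈ A p q, dv (p + 1) q (a - dh p q b) = 0 := by
    intro q
    induction q with
    | zero =>
      intro _ p a ha e he h
      have hz : a - dh p 0 e ∈ B (p + 1) 0 := sub_mem (hAB _ _ ha) (hBh _ _ _ he)
      have hdz : dh (p + 1) 0 (a - dh p 0 e) = dh (p + 1) 0 a := by
        rw [map_sub, hhh, sub_zero]
      obtain ⟨z', hz', hv, hh⟩ := bot p _ hz h (by rw [hdz]; exact hAh _ _ _ ha)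
      obtain ⟨b, hb, hba⟩ := rowEx p 0 (a - z') (sub_mem ha hz')
        (by rw [map_sub, hh, hdz, sub_self])
      refine ⟨b, hb, ?_⟩
      rw [hba, sub_sub_cancel, hv]
    | succ q ih =>
      intro hq p a ha e he h
      obtain ⟨c, hc, hca⟩ := colB p q _ (sub_mem (hAB _ _ ha) (hBh _ _ _ he)) h
      have hda : dh (p + 1) (q + 1) a = dv (p + 2) q (dh (p + 1) q c) := by
        rw [← hcomm, hca, map_sub, hhh, sub_zero]
      obtain ⟨a', ha', haa⟩ := colA (p + 1) q (by omega) _ (hAh _ _ _ ha)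
        (by rw [hda, hvv])
      obtain ⟨b', hb', hbb⟩ := ih (by omega) (p + 1) a' ha' c hc
        (by rw [map_sub, haa, hda, sub_self])
      rw [map_sub, sub_eq_zero, haa] at hbb
      obtain ⟨b, hb, hba⟩ := rowEx p (q + 1) (a - dv (p + 1) q b')
        (sub_mem ha (hAv _ _ _ hb')) (by rw [map_sub, hcomm, hbb, sub_self])
      refine ⟨b, hb, ?_⟩
      rw [hba, sub_sub_cancel, hvv]
  obtain ⟨u, hu, huf⟩ := hu
  obtain ⟨a, ha, haf⟩ := h1
  obtain ⟨b, hb, hab⟩ := L m le_rfl 0 a ha u hu (by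
    rw [map_sub, haf, ← huf, hcomm, sub_self])
  rw [map_sub, sub_eq_zero] at hab
  refine ⟨b, hb, ?_⟩
  have := rowInj (m + 1) (f - dv 0 m b) (sub_mem hf (hAv _ _ _ hb))
    (by rw [map_sub, hcomm, ← hab, haf, sub_self])
  exact (sub_eq_zero.1 this).symm

section DC

variable {G X Y T : Type} [Group G] [MulAction G X] [MulAction G Y]

/-- Horizontal differential. -/
noncomputable def dhor (T Y : Type) (gen : ∀ p, (Fin p → X) → Prop) (p q : ℕ) :
    (T → (Fin p → X) → (Fin (q + 1) → Y) → ℝ) →+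
      (T → (Fin (p + 1) → X) → (Fin (q + 1) → Y) → ℝ) := by
  classical
  exact
  { toFun := fun f t x y => if gen (p + 1) x then cD (fun z => f t z y) x else 0
    map_zero' := by
      funext t x y
      show (if gen (p + 1) x then cD (fun z => (0 : ℝ)) x else 0) = 0
      rw [cD_zero]; simp
    map_add' := fun f g => by
      funext t x y
      show (if gen (p + 1) x then cD (fun z => f t z y + g t z y) x else 0) =
        (if gen (p + 1) x then _ else 0) + (if gen (p + 1) x then _ else 0)
      rw [cD_add]; split_ifs <;> simp }

theorem dhor_gen (gen : ∀ p, (Fin p → X) → Prop) (p q : ℕ)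
    (f : T → (Fin p → X) → (Fin (q + 1) → Y) → ℝ) (t : T) (x : Fin (p + 1) → X)
    (y : Fin (q + 1) → Y) (hx : gen (p + 1) x) :
    dhor T Y gen p q f t x y = cD (fun z => f t z y) x := by
  simp [dhor, hx]

theorem dhor_not (gen : ∀ p, (Fin p → X) → Prop) (p q : ℕ)
    (f : T → (Fin p → X) → (Fin (q + 1) → Y) → ℝ) (t : T) (x : Fin (p + 1) → X)
    (y : Fin (q + 1) → Y) (hx : ¬ gen (p + 1) x) :
    dhor T Y gen p q f t x y = 0 := by
  simp [dhor, hx]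

/-- Vertical differential. -/
noncomputable def dver (T X Y : Type) (p q : ℕ) :
    (T → (Fin p → X) → (Fin (q + 1) → Y) → ℝ) →+
      (T → (Fin p → X) → (Fin (q + 2) → Y) → ℝ) where
  toFun := fun f t x y => cD (f t x) y
  map_zero' := by
    funext t x y
    show cD (fun z => (0 : ℝ)) y = 0
    rw [cD_zero]
  map_add' := fun f g => by
    funext t x y
    show cD (fun z => f t x z + g t x z) y = cD (f t x) y + cD (g t x) y
    rw [cD_add]

theorem dver_apply (p q : ℕ) (f : T → (Fin p → X) → (Fin (q + 1) → Y) → ℝ) (t : T)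
    (x : Fin p → X) (y : Fin (q + 2) → Y) : dver T X Y p q f t x y = cD (f t x) y := rfl

/-- Bounded `Φ`-invariant cochains supported on generic tuples. -/
def bic (T Y : Type) [MulAction G Y] (gen : ∀ p, (Fin p → X) → Prop) (Φ : Set G) (p q : ℕ) :
    AddSubgroup (T → (Fin p → X) → (Fin (q + 1) → Y) → ℝ) where
  carrier := {f | (∃ C, ∀ t x y, |f t x y| ≤ C) ∧ (∀ t x y, ¬ gen p x → f t x y = 0) ∧
    ∀ g ∈ Φ, ∀ t x y, f t (g • x) (g • y) = f t x y}
  zero_mem' := ⟨⟨0, fun t x y => by simp⟩, fun t x y _ => rfl, fun g _ t x y => rfl⟩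
  add_mem' := by
    rintro f f' ⟨⟨C, hC⟩, h1, h2⟩ ⟨⟨C', hC'⟩, h1', h2'⟩
    refine ⟨⟨C + C', fun t x y => ?_⟩, fun t x y hx => ?_, fun g hg t x y => ?_⟩
    · exact (abs_add_le _ _).trans (add_le_add (hC t x y) (hC' t x y))
    · simp [h1 t x y hx, h1' t x y hx]
    · simp [h2 g hg t x y, h2' g hg t x y]
  neg_mem' := by
    rintro f ⟨⟨C, hC⟩, h1, h2⟩
    refine ⟨⟨C, fun t x y => ?_⟩, fun t x y hx => ?_, fun g hg t x y => ?_⟩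
    · simpa using hC t x y
    · simp [h1 t x y hx]
    · simp [h2 g hg t x y]

theorem mem_bic (gen : ∀ p, (Fin p → X) → Prop) (Φ : Set G) (p q : ℕ)
    (f : T → (Fin p → X) → (Fin (q + 1) → Y) → ℝ) : f ∈ bic T Y gen Φ p q ↔
    (∃ C, ∀ t x y, |f t x y| ≤ C) ∧ (∀ t x y, ¬ gen p x → f t x y = 0) ∧
    ∀ g ∈ Φ, ∀ t x y, f t (g • x) (g • y) = f t x y := Iff.rfl

theorem cD_bd {Z : Type*} {n : ℕ} (f : (Fin n → Z) → ℝ) (C : ℝ) (h : ∀ z, |f z| ≤ C)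
    (z : Fin (n + 1) → Z) : |cD f z| ≤ (n + 1) * C := by
  unfold cD
  refine (Finset.abs_sum_le_sum_abs _ _).trans ?_
  refine (Finset.sum_le_sum (fun i _ => (show _ ≤ C from ?_))).trans ?_
  · rw [abs_mul, abs_pow]; simpa using h _
  · simp

theorem cD_congr {Z : Type*} {n : ℕ} (f f' : (Fin n → Z) → ℝ) (z : Fin (n + 1) → Z)
    (h : ∀ i : Fin (n + 1), f (z ∘ i.succAbove) = f' (z ∘ i.succAbove)) : cD f z = cD f' z := by
  unfold cD
  exact Finset.sum_congr rfl fun i _ => by rw [h]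

theorem dc (c : Y → G) (hc : ∀ (g : G) y, c (g • y) = g * c y)
    (gen : ∀ p, (Fin p → X) → Prop) (gen0 : ∀ x, gen 0 x)
    (gface : ∀ p (x : Fin (p + 1) → X) i, gen (p + 1) x → gen p (x ∘ Fin.succAbove i))
    (gsmul : ∀ p (g : G) (x : Fin p → X), gen p x → gen p (g • x))
    (U : Ultrafilter X)
    (hU : ∀ p (xs : Fin p → X), gen p xs → ∀ᶠ x in (U : Filter X), gen (p + 1) (Fin.cons x xs))
    (Φ : Set G) (κ : X → Y) (hκ : ∀ g ∈ Φ, ∀ x, κ (g • x) = g • κ x)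
    (S : ℕ → Set G) (bb : ∀ p, (Fin (p + 1) → X) → (Fin (p + 1) → X))
    (s : ∀ p, (Fin (p + 1) → X) → G)
    (hb1 : ∀ p x, gen (p + 1) x → s p x • bb p x = x)
    (hb2 : ∀ p x (g : G), gen (p + 1) x → bb p (g • x) = bb p x)
    (hs : ∀ p x (g : G), gen (p + 1) x → (s p (g • x))⁻¹ * g * s p x ∈ S p)
    (hS : ∀ p x (g : G), gen (p + 1) x → g ∈ S p → g • bb p x = bb p x)
    (m : ℕ) (hEx : ∀ p q, q < m → Ex (fun (r : S p) (y : Y) => r.1 • y) q)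
    (F : T → (Fin (m + 2) → Y) → ℝ) (hFb : Bd F) (hFi : InvF (fun (g : G) (y : Y) => g • y) F)
    (hu : Cob (fun (r : Φ) (y : Y) => r.1 • y) F)
    (h1 : Cob (fun (r : S 0) (y : Y) => r.1 • y) F)
    (hbot : ∀ p (z : T → (Fin (p + 1) → X) → ℝ), (∃ C, ∀ t x, |z t x| ≤ C) →
      (∀ t x, ¬ gen (p + 1) x → z t x = 0) → (∀ g ∈ Φ, ∀ t x, z t (g • x) = z t x) →
      (∀ (g : G) t x, gen (p + 2) x → cD (z t) (g • x) = cD (z t) x) →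
      ∃ z' : T → (Fin (p + 1) → X) → ℝ, (∃ C, ∀ t x, |z' t x| ≤ C) ∧
        (∀ t x, ¬ gen (p + 1) x → z' t x = 0) ∧ (∀ (g : G) t x, z' t (g • x) = z' t x) ∧
        ∀ t x, gen (p + 2) x → cD (z' t) x = cD (z t) x) :
    Cob (fun (g : G) (y : Y) => g • y) F := by
  classical
  have gsmul' : ∀ p (g : G) (x : Fin p → X), gen p (g • x) ↔ gen p x := fun p g x =>
    ⟨fun h => by simpa using gsmul p g⁻¹ _ h, gsmul p g x⟩
  have hdh : ∀ (Ψ : Set G) p q a, a ∈ bic T Y gen Ψ p q →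
      dhor T Y gen p q a ∈ bic T Y gen Ψ (p + 1) q := by
    rintro Ψ p q a ⟨⟨C, hC⟩, ha1, ha2⟩
    refine ⟨⟨(p + 1) * C, fun t x y => ?_⟩, fun t x y hx => dhor_not gen p q a t x y hx,
      fun g hg t x y => ?_⟩
    · by_cases hx : gen (p + 1) x
      · rw [dhor_gen gen p q a t x y hx]; exact cD_bd _ _ (fun z => hC _ _ _) _
      · rw [dhor_not gen p q a t x y hx, abs_zero]
        have := (abs_nonneg _).trans (hC t (x ∘ Fin.succAbove 0) y)
        positivity
    · by_cases hx : gen (p + 1) x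
      · rw [dhor_gen gen p q a t x y hx, dhor_gen gen p q a t _ _ (gsmul _ g x hx)]
        exact Finset.sum_congr rfl fun i _ => by
          congr 1; exact ha2 g hg t (x ∘ Fin.succAbove i) y
      · rw [dhor_not gen p q a t x y hx, dhor_not gen p q a t _ _ (by rwa [gsmul'])]
  -- the column lemma
  have col : ∀ p q (a : T → (Fin (p + 1) → X) → (Fin (q + 2) → Y) → ℝ),
      a ∈ bic T Y gen (Set.univ : Set G) (p + 1) (q + 1) →
      Cob (T := T × (Fin (p + 1) → X)) (fun (r : S p) (y : Y) => r.1 • y)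
        (fun t y => if gen (p + 1) t.2 then a t.1 (bb p t.2) y else 0) →
      ∃ c ∈ bic T Y gen (Set.univ : Set G) (p + 1) q, dver T X Y (p + 1) q c = a := by
    rintro p q a ⟨-, ha1, ha2⟩ ⟨h, ⟨C, hC⟩, hi, hd⟩
    refine ⟨fun t x y => if gen (p + 1) x then h (t, bb p x) ((s p x)⁻¹ • y) else 0,
      ⟨⟨C, fun t x y => ?_⟩, fun t x y hx => if_neg hx, fun g _ t x y => ?_⟩, ?_⟩
    · dsimp only
      split_ifs
      · exact hC _ _
      · rw [abs_zero]; exact (abs_nonneg _).trans (hC (t, x) y)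
    · dsimp only
      by_cases hx : gen (p + 1) x
      · rw [if_pos hx, if_pos (gsmul _ g x hx), hb2 p x g hx]
        have := hi ⟨_, hs p x g hx⟩ (t, bb p x) ((s p x)⁻¹ • y)
        rw [← this]
        congr 1
        funext i
        simp [smul_smul, mul_assoc]
      · rw [if_neg hx, if_neg (by rwa [gsmul'])]
    · funext t x y
      rw [dver_apply]
      by_cases hx : gen (p + 1) x
      · simp only [if_pos hx]
        have hbx : bb p x = (s p x)⁻¹ • x := by
          rw [eq_inv_smul_iff]; exact hb1 p x hx
        have hgb : gen (p + 1) (bb p x) := by rw [hbx]; exact gsmul _ _ _ hx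
        have hbb : bb p (bb p x) = bb p x := by
          conv_lhs => rw [hbx]
          rw [hb2 p x _ hx]
        have e := congrFun (hd (t, bb p x)) ((s p x)⁻¹ • y)
        simp only [hgb, if_true, hbb] at e
        have e2 := ha2 (s p x)⁻¹ trivial t x y
        rw [← hbx] at e2
        rw [← e2, ← e]
        exact cD_comp (h (t, bb p x)) (fun y => (s p x)⁻¹ • y) y
      · simp only [if_neg hx, ha1 t x y hx, cD_zero]
  have key := zigzag (M := fun p q => T → (Fin p → X) → (Fin (q + 1) → Y) → ℝ)
    (dhor T Y gen) (dver T X Y) ?_ ?_ ?_ (bic T Y gen (Set.univ : Set G)) (bic T Y gen Φ) ?_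
    (hdh _) ?_ (hdh _) ?_ ?_ m ?_ ?_ ?_ (fun t _ y => F t y) ?_ ?_ ?_
  · obtain ⟨b, ⟨⟨C, hC⟩, -, hb⟩, hbF⟩ := key
    refine ⟨fun t y => b t Fin.elim0 y, ⟨C, fun t y => hC _ _ _⟩, fun g t y => ?_, fun t => ?_⟩
    · have := hb g trivial t Fin.elim0 y
      refine Eq.trans ?_ this
      show b t Fin.elim0 _ = b t _ _
      congr 1
      exact Subsingleton.elim _ _
    · funext y
      exact congrFun (congrFun (congrFun hbF t) Fin.elim0) y
  · -- commutation
    intro p q a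
    funext t x y
    rw [dver_apply]
    by_cases hx : gen (p + 1) x
    · rw [dhor_gen _ _ _ _ _ _ _ hx]
      have : dhor T Y gen p q a t x = fun y => cD (fun z => a t z y) x := by
        funext y; rw [dhor_gen _ _ _ _ _ _ _ hx]
      rw [this]
      simp only [cD, dver_apply, Finset.mul_sum]
      rw [Finset.sum_comm]
      refine Finset.sum_congr rfl fun i _ => Finset.sum_congr rfl fun j _ => ?_
      ring
    · rw [dhor_not _ _ _ _ _ _ _ hx]
      have : dhor T Y gen p q a t x = fun y => 0 := by
        funext y; rw [dhor_not _ _ _ _ _ _ _ hx]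
      rw [this, cD_zero]
  · intro p q a
    funext t x y
    by_cases hx : gen (p + 2) x
    · rw [dhor_gen _ _ _ _ _ _ _ hx]
      rw [cD_congr _ (cD (fun z => a t z y)) x, cD_cD]
      · rfl
      · intro i
        rw [dhor_gen _ _ _ _ _ _ _ (gface _ _ i hx)]
    · rw [dhor_not _ _ _ _ _ _ _ hx]; rfl
  · intro p q a
    funext t x y
    show cD (cD (a t x)) y = 0
    rw [cD_cD]
  · rintro p q a ⟨h1, h2, h3⟩
    exact ⟨h1, h2, fun g _ => h3 g trivial⟩
  · -- dver preserves
    rintro p q a ⟨⟨C, hC⟩, ha1, ha2⟩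
    refine ⟨⟨((q + 1 : ℕ) + 1) * C, fun t x y => by
      rw [dver_apply]; exact cD_bd (a t x) C (fun z => hC _ _ _) y⟩,
      fun t x y hx => ?_, fun g hg t x y => ?_⟩
    · rw [dver_apply]
      have : a t x = fun _ => 0 := by funext z; exact ha1 t x z hx
      rw [this, cD_zero]
    · rw [dver_apply, dver_apply]
      exact Finset.sum_congr rfl fun i _ => by
          congr 1; exact ha2 g hg t x (y ∘ Fin.succAbove i)
  · -- row injectivity
    rintro q a - h
    funext t x y
    obtain ⟨x0, hx0⟩ := (hU 0 x (gen0 x)).exists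
    have := congrFun (congrFun (congrFun h t) (Fin.cons x0 x)) y
    rw [dhor_gen _ _ _ _ _ _ _ hx0] at this
    simp only [cD, Nat.reduceAdd, Finset.univ_unique, Fin.default_eq_zero, Finset.sum_singleton,
      Fin.val_zero, pow_zero, one_mul, Pi.zero_apply] at this
    refine Eq.trans ?_ this
    show a t x y = a t _ y
    congr 1
  · -- row exactness
    rintro p q a ⟨⟨C, hC⟩, ha1, ha2⟩ h
    refine ⟨fun t x y => if gen p x then
      limUnder (U : Filter X) (fun x0 => a t (Fin.cons (c (y 0) • x0) x) y) else 0,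
      ⟨⟨C, fun t x y => ?_⟩, fun t x y hx => if_neg hx, fun g _ t x y => ?_⟩, ?_⟩
    · dsimp only
      split_ifs
      · exact ulim_bd _ _ _ (fun _ => hC _ _ _)
      · rw [abs_zero]
        obtain ⟨x0⟩ : Nonempty X := nonempty_of_neBot (U : Filter X)
        exact (abs_nonneg _).trans (hC t (fun _ => x0) y)
    · dsimp only
      by_cases hx : gen p x
      · rw [if_pos hx, if_pos (gsmul _ g x hx)]
        congr 1
        funext x0
        rw [← ha2 g trivial t _ y]
        congr 1
        funext i
        refine Fin.cases ?_ (fun j => ?_) i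
        · simp [hc, mul_smul]
        · simp
      · rw [if_neg hx, if_neg (by rwa [gsmul'])]
    · funext t x y
      by_cases hx : gen (p + 1) x
      · rw [dhor_gen _ _ _ _ _ _ _ hx]
        set g := c (y 0) with hg
        have e0 : ∀ᶠ x0 in (U : Filter X), a t x y =
            cD (fun z => a t (Fin.cons (g • x0) z) y) x := by
          have := hU _ (g⁻¹ • x) (gsmul _ _ _ hx)
          filter_upwards [this] with x0 hx0
          have hx1 : gen (p + 2) (Fin.cons (g • x0) x) := by
            have := gsmul _ g _ hx0
            convert this using 1
            funext i
            refine Fin.cases ?_ (fun j => ?_) i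
            · simp
            · simp
          have := congrFun (congrFun (congrFun h t) (Fin.cons (g • x0) x)) y
          rw [dhor_gen _ _ _ _ _ _ _ hx1, cD_cons] at this
          simp only [Pi.zero_apply] at this
          linarith
        have e1 : Tendsto (fun x0 => cD (fun z => a t (Fin.cons (g • x0) z) y) x) U
            (𝓝 (cD (fun z => if gen p z then
              limUnder (U : Filter X) (fun x0 => a t (Fin.cons (g • x0) z) y) else 0) x)) := by
          unfold cD
          refine tendsto_finsetSum _ fun i _ => ?_
          refine Tendsto.const_mul _ ?_
          simp only [if_pos (gface _ _ i hx)]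
          exact ulim_exists _ _ C (fun _ => hC _ _ _)
        have e2 : Tendsto (fun _ : X => a t x y) U _ := e1.congr' (by
          filter_upwards [e0] with x0 h0 using h0.symm)
        exact tendsto_nhds_unique e2 tendsto_const_nhds
      · rw [dhor_not _ _ _ _ _ _ _ hx, ha1 t x y hx]
  · -- columns of A
    rintro p q hq a ha hda
    refine col p q a ha (hEx p q hq _ _ ?_ ?_ ?_)
    · obtain ⟨⟨C, hC⟩, -⟩ := ha
      refine ⟨C, fun t y => ?_⟩
      dsimp only
      split_ifs
      · exact hC _ _ _
      · rw [abs_zero]; exact (abs_nonneg _).trans (hC t.1 t.2 y)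
    · intro r t y
      dsimp only
      split_ifs with hx
      · rw [← ha.2.2 r.1 trivial t.1 (bb p t.2) y, hS p t.2 r.1 hx r.2]
        rfl
      · rfl
    · intro t
      split_ifs with hx
      · exact congrFun (congrFun hda t.1) _
      · exact cD_zero
  · -- columns of B
    rintro p q a ⟨⟨C, hC⟩, ha1, ha2⟩ hda
    refine ⟨fun t x y => a t x (Fin.cons (κ (x 0)) y), ⟨⟨C, fun t x y => hC _ _ _⟩,
      fun t x y hx => ha1 _ _ _ hx, fun g hg t x y => ?_⟩, ?_⟩
    · dsimp only
      rw [← ha2 g hg t x (Fin.cons (κ (x 0)) y)]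
      congr 1
      funext i
      refine Fin.cases ?_ (fun j => ?_) i
      · simp [hκ g hg]
      · simp
    · funext t x y
      exact cD_cone (a t x) (congrFun (congrFun hda t) x) _ y
  · -- bottom
    rintro p z ⟨⟨C, hC⟩, hz1, hz2⟩ hdz hdA
    obtain ⟨y0⟩ : Nonempty Y := by
      obtain ⟨x0⟩ : Nonempty X := nonempty_of_neBot (U : Filter X)
      exact ⟨κ x0⟩
    have hzy : ∀ t x y y', z t x y = z t x y' := by
      intro t x y y'
      have := cD_cone (z t x) (congrFun (congrFun hdz t) x) (y' 0) y
      rw [← this]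
      simp only [cD, Nat.reduceAdd, Finset.univ_unique, Fin.default_eq_zero, Finset.sum_singleton,
        Fin.val_zero, pow_zero, one_mul]
      congr 1
      funext i; fin_cases i; rfl
    obtain ⟨z', ⟨C', hC'⟩, h1, h2, h3⟩ := hbot p (fun t x => z t x (fun _ => y0))
      ⟨C, fun t x => hC _ _ _⟩ (fun t x hx => hz1 _ _ _ hx)
      (fun g hg t x => by rw [← hz2 g hg t x (fun _ => y0)]; exact hzy _ _ _ _)
      (fun g t x hx => by
        have := hdA.2.2 g trivial t x (fun _ => y0)
        rw [dhor_gen _ _ _ _ _ _ _ hx, dhor_gen _ _ _ _ _ _ _ (gsmul _ g _ hx)] at this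
        rw [← this]
        congr 1
        funext w; exact hzy _ _ _ _)
    refine ⟨fun t x _ => z' t x, ⟨⟨C', fun t x y => hC' t x⟩, fun t x y hx => h1 t x hx,
      fun g _ t x y => h2 g t x⟩, ?_, ?_⟩
    · funext t x y
      rw [dver_apply, cD_const]
      have h0 : eps 0 = 0 := by simp [eps]
      simp [eps_succ, h0]
    · funext t x y
      by_cases hx : gen (p + 2) x
      · rw [dhor_gen _ _ _ _ _ _ _ hx, dhor_gen _ _ _ _ _ _ _ hx, h3 t x hx]
        congr 1
        funext w; exact hzy _ _ _ _
      · rw [dhor_not _ _ _ _ _ _ _ hx, dhor_not _ _ _ _ _ _ _ hx]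
  · obtain ⟨C, hC⟩ := hFb
    refine ⟨⟨C, fun t _ y => hC t y⟩, fun t x y hx => absurd (gen0 x) hx, fun g _ t x y => ?_⟩
    exact hFi g t y
  · obtain ⟨u, ⟨C, hC⟩, hi, hd⟩ := hu
    refine ⟨fun t _ y => u t y, ⟨⟨C, fun t _ y => hC t y⟩, fun t x y hx => absurd (gen0 x) hx,
      fun g hg t x y => hi ⟨g, hg⟩ t y⟩, ?_⟩
    funext t x y
    exact congrFun (hd t) y
  · have hFA : (fun t (_ : Fin 0 → X) y => F t y) ∈ bic T Y gen (Set.univ : Set G) 0 (m + 1) := by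
      obtain ⟨C, hC⟩ := hFb
      refine ⟨⟨C, fun t _ y => hC t y⟩, fun t x y hx => absurd (gen0 x) hx, fun g _ t x y => ?_⟩
      exact hFi g t y
    refine col 0 m _ (hdh _ _ _ _ hFA) ?_
    obtain ⟨u, ⟨C, hC⟩, hi, hd⟩ := h1
    refine ⟨fun t y => if gen 1 t.2 then u t.1 y else 0, ⟨C, fun t y => ?_⟩, fun r t y => ?_,
      fun t => ?_⟩
    · dsimp only
      split_ifs
      · exact hC _ _
      · rw [abs_zero]; exact (abs_nonneg _).trans (hC t.1 y)
    · dsimp only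
      rw [hi]
    · funext y
      by_cases hx : gen 1 t.2
      · have hgb : gen 1 (bb 0 t.2) := by
          rw [← gsmul' _ (s 0 t.2), hb1 0 t.2 hx]; exact hx
        simp only [if_pos hx]
        rw [hd, dhor_gen _ _ _ _ _ _ _ hgb, cD_const]
        have h0 : eps 0 = 0 := by simp [eps]
        simp [eps_succ, h0]
      · simp only [if_neg hx, cD_zero]

end DC

end HC

namespace HC
open Filter Topology

/-! ### The Kuenneth argument -/

/-- Vanishing in degree `m + 1` for all free actions of `H`. -/
def Acy (H : Type) [Group H] (m : ℕ) : Prop :=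
  ∀ (Y : Type) [MulAction H Y], (∀ (h : H) (y : Y), h • y = y → h = 1) →
    Ex (fun (h : H) (y : Y) => h • y) m

theorem exists_equivariant {H Y : Type} [Group H] [MulAction H Y]
    (hf : ∀ (h : H) (y : Y), h • y = y → h = 1) :
    ∃ c : Y → H, ∀ (g : H) y, c (g • y) = g * c y := by
  have : ∀ y : Y, ∃ g : H, g • (Quotient.out (Quotient.mk (MulAction.orbitRel H Y) y)) = y := by
    intro y
    have := Quotient.exact (Quotient.out_eq (Quotient.mk (MulAction.orbitRel H Y) y))
    have h2 := (MulAction.orbitRel H Y).symm this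
    exact h2
  choose c hc using this
  refine ⟨c, fun g y => ?_⟩
  have e : (Quotient.mk (MulAction.orbitRel H Y) (g • y)) = Quotient.mk _ y :=
    Quotient.sound ⟨g, rfl⟩
  have h1 := hc (g • y)
  rw [e] at h1
  set o := Quotient.out (Quotient.mk (MulAction.orbitRel H Y) y)
  have h2 : ((g * c y)⁻¹ * c (g • y)) • o = o := by
    rw [mul_smul, h1, inv_smul_eq_iff, mul_smul, hc y]
  have := hf _ _ h2
  rw [inv_mul_eq_one] at this
  exact this.symm

theorem Acy.via {H G Y : Type} [Group H] [Group G] [MulAction G Y] {q : ℕ} (hA : Acy H q)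
    (ι : H →* G) (hf : ∀ (h : H) (y : Y), ι h • y = y → h = 1) :
    Ex (fun (h : H) (y : Y) => ι h • y) q :=
  @hA Y (MulAction.compHom Y ι) hf

theorem Cob.reindex {R R' T Y : Type} {n : ℕ} {σ : R → Y → Y} {τ : R' → Y → Y}
    {F : T → (Fin (n + 1) → Y) → ℝ} (h : Cob τ F) (j : R → R')
    (hj : ∀ r y, σ r y = τ (j r) y) : Cob σ F :=
  h.pull id j hj

theorem kun1 {H T : Type} [Group H] (m : ℕ) (hA : ∀ q < m, Acy H q)
    (F : T → (Fin (m + 2) → H × H) → ℝ) (hFb : Bd F)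
    (hFi : InvF (fun (g : H × H) y => g * y) F)
    (h1 : Cob (fun (a : H) (y : H × H) => (a, 1) * y) F)
    (h2 : Cob (fun (b : H) (y : H × H) => (1, b) * y) F) :
    Cob (fun (g : H × H) y => g * y) F := by
  letI act : MulAction (H × H) H := MulAction.compHom H (MonoidHom.fst H H)
  have hact : ∀ (g : H × H) (x : H), g • x = g.1 * x := fun g x => rfl
  have := dc (G := H × H) (X := H) (Y := H × H) (T := T) id (fun g y => rfl)
    (fun _ _ => True) (fun _ => trivial) (fun _ _ _ _ => trivial) (fun _ _ _ _ => trivial)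
    (pure 1) (fun _ _ _ => Eventually.of_forall fun _ => trivial)
    {g | g.2 = 1} (fun x => (x, 1)) (by
      intro g hg x
      have hg : g.2 = 1 := hg
      ext <;> simp [hact, hg])
    (fun _ => {g | g.1 = 1}) (fun p x i => (x 0)⁻¹ * x i) (fun p x => (x 0, 1))
    (by intro p x _; funext i; simp [hact])
    (by intro p x g _; funext i; simp [hact])
    (by intro p x g _; simp [hact])
    (by
      intro p x g _ hg
      have hg : g.1 = 1 := hg
      funext i; simp [hact, hg])
    m ?_ F hFb hFi
    (h1.reindex (fun r => r.1.1) (by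
      rintro ⟨⟨a, b⟩, h⟩ y
      have h : b = 1 := h
      subst h; rfl))
    (h2.reindex (fun r => r.1.2) (by
      rintro ⟨⟨a, b⟩, h⟩ y
      have h : a = 1 := h
      subst h; rfl)) ?_
  · exact this
  · intro p q hq T' F' hb hi hc
    have := (hA q hq).via (Y := H × H) (MonoidHom.inr H H) (fun h y e => by
      have := congrArg Prod.snd e
      simpa using this) T' F' hb (fun r t y => hi ⟨(1, r), rfl⟩ t y) hc
    exact this.reindex (fun r => r.1.2) (by
      rintro ⟨⟨a, b⟩, h⟩ y
      have h : a = 1 := h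
      subst h; rfl)
  · intro p z hz1 hz2 hz3 hz4
    refine ⟨z, hz1, hz2, fun g t x => ?_, fun _ _ _ => rfl⟩
    exact hz3 (g.1, 1) rfl t x

theorem kun {H G T Y : Type} [Group H] [Group G] [MulAction G Y] (i j : H →* G)
    (hij : ∀ a b, i a * j b = j b * i a) (ρ : G) (hρ : ∀ h, ρ * (i h * j h) = j h * ρ)
    (hinj : Function.Injective i) (hfree : ∀ (g : G) (y : Y), g • y = y → g = 1)
    (m : ℕ) (hA : ∀ q < m, Acy H q)
    (F : T → (Fin (m + 2) → Y) → ℝ) (hFb : Bd F)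
    (hFi : InvF (fun (g : G) (y : Y) => g • y) F) (hFc : ∀ t, cD (F t) = fun _ => 0) :
    Cob (fun (h : H) (y : Y) => i h • y) F := by
  rcases isEmpty_or_nonempty Y with hY | ⟨⟨y0⟩⟩
  · refine ⟨fun _ _ => 0, ⟨0, by simp⟩, fun _ _ _ => rfl, fun t => ?_⟩
    funext y
    exact (hY.false (y 0)).elim
  obtain ⟨C, hC⟩ := hFb
  have hFb : Bd F := ⟨C, hC⟩
  let α : H × H → Y := fun γ => (i γ.1 * j γ.2) • y0
  let α1 : H × H → Y := fun γ => i γ.1 • y0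
  let α2 : H × H → Y := fun γ => j γ.2 • y0
  let E : T → (Fin (m + 2) → H × H) → ℝ := fun t γ => F t (α ∘ γ) - F t (α1 ∘ γ) - F t (α2 ∘ γ)
  have hEb : Bd E := ⟨C + C + C, fun t γ => by
    have h1 := abs_le.1 (hC t (α ∘ γ))
    have h2 := abs_le.1 (hC t (α1 ∘ γ))
    have h3 := abs_le.1 (hC t (α2 ∘ γ))
    show |F t (α ∘ γ) - F t (α1 ∘ γ) - F t (α2 ∘ γ)| ≤ _
    rw [abs_le]; constructor <;> linarith⟩
  have hEi : InvF (fun (g : H × H) y => g * y) E := by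
    intro g t γ
    have e0 : F t (α ∘ (fun y => g * y) ∘ γ) = F t (α ∘ γ) := by
      rw [← hFi (i g.1 * j g.2) t (α ∘ γ)]
      congr 1; funext k
      simp only [α, Function.comp, Prod.fst_mul, Prod.snd_mul, map_mul, smul_smul]
      congr 1
      rw [mul_assoc, mul_assoc, ← mul_assoc (j g.2), ← hij, mul_assoc]
    have e1 : F t (α1 ∘ (fun y => g * y) ∘ γ) = F t (α1 ∘ γ) := by
      rw [← hFi (i g.1) t (α1 ∘ γ)]
      congr 1; funext k
      simp only [α1, Function.comp, Prod.fst_mul, map_mul, smul_smul]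
    have e2 : F t (α2 ∘ (fun y => g * y) ∘ γ) = F t (α2 ∘ γ) := by
      rw [← hFi (j g.2) t (α2 ∘ γ)]
      congr 1; funext k
      simp only [α2, Function.comp, Prod.snd_mul, map_mul, smul_smul]
    show F t (α ∘ (fun y => g * y) ∘ γ) - F t (α1 ∘ (fun y => g * y) ∘ γ)
      - F t (α2 ∘ (fun y => g * y) ∘ γ) = _
    rw [e0, e1, e2]
  have hEc : ∀ t, cD (E t) = fun _ => 0 := by
    intro t; funext γ
    show cD (fun γ => F t (α ∘ γ) - F t (α1 ∘ γ) - F t (α2 ∘ γ)) γ = 0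
    rw [cD_sub (fun γ => F t (α ∘ γ) - F t (α1 ∘ γ)) _ γ, cD_sub, cD_comp, cD_comp, cD_comp, hFc]
    simp
  have hk : ∀ {R : Type} (σ : R → H × H → H × H),
      Cob σ (fun t (_ : Fin (m + 2) → H × H) => - F t (fun _ => y0)) := by
    intro R σ
    refine (Cob.const σ (fun t => F t (fun _ => y0)) ⟨C, fun t => hC t _⟩ ?_).neg
    intro t; funext γ
    have := cD_comp (F t) (fun _ : H × H => y0) γ
    rw [hFc] at this
    exact this
  have h1 : Cob (fun (a : H) (y : H × H) => (a, 1) * y) E := by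
    refine Cob.transfer hEb hEi hEc (fun γ => (γ.1, 1)) id (fun a => (a, 1)) ?_ ?_ ?_
    · intro r y; simp
    · intro r y; rfl
    · convert hk (fun (a : H) (y : H × H) => (a, 1) * y) using 3 with t γ
      show F t (fun k => (i (γ k).1 * j 1) • y0) - F t (fun k => i (γ k).1 • y0)
        - F t (fun k => j 1 • y0) = _
      simp
  have h2 : Cob (fun (b : H) (y : H × H) => (1, b) * y) E := by
    refine Cob.transfer hEb hEi hEc (fun γ => (1, γ.2)) id (fun a => (1, a)) ?_ ?_ ?_
    · intro r y; simp
    · intro r y; rfl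
    · convert hk (fun (b : H) (y : H × H) => (1, b) * y) using 3 with t γ
      show F t (fun k => (i 1 * j (γ k).2) • y0) - F t (fun k => i 1 • y0)
        - F t (fun k => j (γ k).2 • y0) = _
      simp
  have h3 := kun1 m hA E hEb hEi h1 h2
  have h4 : Cob (fun (a : H) (y : H) => a * y)
      (fun t (x : Fin (m + 2) → H) => E t ((fun a => (a, a)) ∘ x)) :=
    h3.pull (fun a => (a, a)) (fun a => (a, a)) (fun r y => rfl)
  have h5 : Cob (fun (a : H) (y : H) => a * y) (fun t (x : Fin (m + 2) → H) =>
      F t ((fun h => (j h * ρ) • y0) ∘ x) - F t ((fun h => j h • y0) ∘ x)) :=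
    Cob.ofPrism hFb hFi hFc _ _ (fun h => j h) (fun r y => by simp [mul_smul])
      (fun r y => by simp [mul_smul])
  have h6 : Cob (fun (a : H) (y : H) => a * y) (fun t (x : Fin (m + 2) → H) =>
      F t ((fun h => i h • y0) ∘ x)) := by
    convert h5.add h4.neg using 3 with t x
    have e : F t (α ∘ (fun a => (a, a)) ∘ x) = F t ((fun h => (j h * ρ) • y0) ∘ x) := by
      rw [← hFi ρ t (α ∘ (fun a => (a, a)) ∘ x)]
      congr 1; funext k
      simp only [α, Function.comp, smul_smul, hρ]
    show _ = _ + - (F t (α ∘ (fun a => (a, a)) ∘ x) - F t ((fun h => i h • y0) ∘ x)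
      - F t ((fun h => j h • y0) ∘ x))
    rw [e]; ring
  letI act : MulAction H Y := MulAction.compHom Y i
  have hact : ∀ (h : H) (y : Y), h • y = i h • y := fun _ _ => rfl
  obtain ⟨c, hc⟩ := exists_equivariant (H := H) (Y := Y) (fun h y e => by
    rw [hact] at e
    have := hfree _ _ e
    exact hinj (by rw [this, map_one]))
  have h7 : Cob (fun (h : H) (y : Y) => i h • y) (fun t (y : Fin (m + 2) → Y) =>
      F t ((fun y => i (c y) • y0) ∘ y)) :=
    h6.pull c id (fun r y => hc r y)
  refine Cob.transfer hFb hFi hFc (fun y => i (c y) • y0) id (fun h => i h) ?_ ?_ h7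
  · intro r y
    have := hc r y
    rw [hact] at this
    rw [this, map_mul, mul_smul]
  · intro r y; rfl

end HC

namespace HC
open Filter Topology

/-! ### The abstract criterion -/

theorem cob_limit {H G T Y : Type} [Group H] [Group G] [MulAction G Y] (i : H →* G)
    (Ss : Set G) (u : ℕ → G)
    (hu2 : ∀ g ∈ Ss, ∀ᶠ k in atTop, ∃ h, u k * g * (u k)⁻¹ = i h) {n : ℕ}
    (F : T → (Fin (n + 1) → Y) → ℝ)
    (hF : Cob (T := T × ℕ) (fun (h : H) (y : Y) => i h • y)
      (fun t y => F t.1 ((fun y => (u t.2)⁻¹ • y) ∘ y))) :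
    Cob (fun (r : Ss) (y : Y) => r.1 • y) F := by
  obtain ⟨f, ⟨C, hC⟩, hi, hd⟩ := hF
  refine ⟨fun t y => limUnder (hyperfilter ℕ : Filter ℕ) (fun k => f (t, k) ((fun y => u k • y) ∘ y)),
    ⟨C, fun t y => ulim_bd _ _ _ (fun k => hC _ _)⟩, ?_, ?_⟩
  · rintro ⟨g, hg⟩ t y
    have : ∀ᶠ k in (hyperfilter ℕ : Filter ℕ), f (t, k) ((fun y => u k • y) ∘ (fun y => g • y) ∘ y)
        = f (t, k) ((fun y => u k • y) ∘ y) := by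
      filter_upwards [Nat.hyperfilter_le_atTop (hu2 g hg)] with k hk
      obtain ⟨h, hh⟩ := hk
      rw [← hi h (t, k) ((fun y => u k • y) ∘ y)]
      congr 1
      funext l
      simp only [Function.comp, ← hh, smul_smul]
      congr 1; group
    show lim (map _ _) = lim (map _ _)
    congr 1
    exact Filter.map_congr this
  · intro t
    funext y
    have e1 : Tendsto (fun k => cD (fun y => f (t, k) ((fun y => u k • y) ∘ y)) y)
        (hyperfilter ℕ) (𝓝 (cD (fun y => limUnder (hyperfilter ℕ : Filter ℕ)
          (fun k => f (t, k) ((fun y => u k • y) ∘ y))) y)) := by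
      unfold cD
      refine tendsto_finsetSum _ fun i _ => ?_
      refine Tendsto.const_mul _ ?_
      exact ulim_exists _ _ C (fun _ => hC _ _)
    have e2 : (fun k => cD (fun y => f (t, k) ((fun y => u k • y) ∘ y)) y) = fun _ => F t y := by
      funext k
      rw [cD_comp, hd]
      dsimp only
      congr 1
      funext l
      simp [Function.comp]
    rw [e2] at e1
    exact tendsto_nhds_unique e1 tendsto_const_nhds

theorem criterion {G X : Type} [Group G] [MulAction G X]
    (gen : ∀ p, (Fin p → X) → Prop) (gen0 : ∀ x, gen 0 x)
    (gface : ∀ p (x : Fin (p + 1) → X) i, gen (p + 1) x → gen p (x ∘ Fin.succAbove i))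
    (gsmul : ∀ p (g : G) (x : Fin p → X), gen p x → gen p (g • x))
    (U : Ultrafilter X)
    (hU : ∀ p (xs : Fin p → X), gen p xs → ∀ᶠ x in (U : Filter X), gen (p + 1) (Fin.cons x xs))
    (htrans : ∀ p (x x' : Fin p → X), gen p x → gen p x' → ∃ g : G, g • x = x')
    (i j : G →* G)
    (hij : ∀ a b, i a * j b = j b * i a) (ρ : G) (hρ : ∀ h, ρ * (i h * j h) = j h * ρ)
    (hinj : Function.Injective i)
    (hstab : ∀ p (x : Fin (p + 1) → X), gen (p + 1) x → ∃ u : ℕ → G,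
      (∀ k h, ((u k)⁻¹ * i h * u k) • x = x) ∧
      (∀ g : G, g • x = x → ∀ᶠ k in atTop, ∃ h, u k * g * (u k)⁻¹ = i h))
    (m : ℕ) : Acy G m := by
  classical
  induction m using Nat.strong_induction_on with
  | _ m ih =>
  intro Y _ hfree T F hFb hFi hFc
  rcases isEmpty_or_nonempty Y with hY | ⟨⟨y0⟩⟩
  · refine ⟨fun _ _ => 0, ⟨0, by simp⟩, fun _ _ _ => rfl, fun t => ?_⟩
    funext y
    exact (hY.false (y 0)).elim
  obtain ⟨c, hc⟩ := exists_equivariant hfree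
  have hex : ∀ p, ∃ x : Fin p → X, gen p x := by
    intro p
    induction p with
    | zero => exact ⟨Fin.elim0, gen0 _⟩
    | succ p ih =>
      obtain ⟨x, hx⟩ := ih
      obtain ⟨x0, hx0⟩ := (hU p x hx).exists
      exact ⟨_, hx0⟩
  choose xx hxx using hex
  have hs : ∀ p (x : Fin (p + 1) → X), ∃ g : G, gen (p + 1) x → g • xx (p + 1) = x := by
    intro p x
    by_cases hx : gen (p + 1) x
    · obtain ⟨g, hg⟩ := htrans _ _ _ (hxx (p + 1)) hx
      exact ⟨g, fun _ => hg⟩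
    · exact ⟨1, fun h => absurd h hx⟩
  choose s hs using hs
  have hstab' := fun p => hstab p _ (hxx (p + 1))
  choose u hu1 hu2 using hstab'
  refine dc c hc gen gen0 gface gsmul U hU ∅ (fun _ => y0) (fun g hg => absurd hg (by simp))
    (fun p => {g | g • xx (p + 1) = xx (p + 1)}) (fun p _ => xx (p + 1)) s hs
    (fun _ _ _ _ => rfl) ?_ (fun _ _ _ _ hg => hg) m ?_ F hFb hFi ?_ ?_ ?_
  · intro p x g hx
    show ((s p (g • x))⁻¹ * g * s p x) • xx (p + 1) = xx (p + 1)
    rw [mul_smul, mul_smul, hs p x hx, inv_smul_eq_iff, hs p _ (gsmul _ _ _ hx)]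
  · intro p q hq T' F' hb hi hc'
    refine cob_limit i _ (u p) (hu2 p) F' ?_
    refine (ih q hq).via (Y := Y) i (fun h y e => ?_) _ _ ?_ ?_ ?_
    · exact hinj (by rw [hfree _ _ e, map_one])
    · obtain ⟨C, hC⟩ := hb
      exact ⟨C, fun t y => hC _ _⟩
    · intro h t y
      have := hi ⟨_, hu1 p t.2 h⟩ t.1 ((fun y => (u p t.2)⁻¹ • y) ∘ y)
      show F' t.1 _ = F' t.1 _
      rw [← this]
      congr 1; funext l
      simp [Function.comp, smul_smul, mul_assoc]
    · intro t
      funext y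
      rw [cD_comp, hc']
  · obtain ⟨C, hC⟩ := hFb
    refine ⟨fun t y => F t (Fin.cons y0 y), ⟨C, fun t y => hC _ _⟩, fun r => (Set.notMem_empty _ r.2).elim,
      fun t => ?_⟩
    funext y
    exact cD_cone (F t) (hFc t) y0 y
  · refine cob_limit i _ (u 0) (hu2 0) F ?_
    have := kun (T := T × ℕ) i j hij ρ hρ hinj hfree m ih (fun t => F t.1)
      (by obtain ⟨C, hC⟩ := hFb; exact ⟨C, fun t y => hC _ _⟩) (fun r t y => hFi r t.1 y)
      (fun t => hFc t.1)
    convert this using 3 with t y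
    exact hFi _ t.1 y
  · intro p z ⟨C, hC⟩ hz1 _ hz2
    have hw : ∀ t (x : Fin (p + 2) → X), gen (p + 2) x → cD (z t) x = cD (z t) (xx (p + 2)) := by
      intro t x hx
      rw [← hs (p + 1) x hx]
      exact hz2 _ _ _ (hxx _)
    refine ⟨fun t x => if gen (p + 1) x then cD (z t) (xx (p + 2)) else 0,
      ⟨((p + 1 : ℕ) + 1) * C, fun t x => ?_⟩, fun t x hx => if_neg hx, fun g t x => ?_,
      fun t x hx => ?_⟩
    · dsimp only
      split_ifs
      · exact cD_bd (z t) C (hC t) _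
      · rw [abs_zero]
        have := (abs_nonneg _).trans (hC t x)
        positivity
    · have : gen (p + 1) (g • x) ↔ gen (p + 1) x :=
        ⟨fun h => by simpa using gsmul _ g⁻¹ _ h, gsmul _ g x⟩
      simp only [this]
    · rw [cD_congr _ (fun _ => cD (z t) (xx (p + 2))) x (fun k => if_pos (gface _ _ k hx)),
        cD_const, hw t x hx]
      have h0 := congrFun (cD_cD (z t)) (xx (p + 3))
      rw [cD_congr _ (fun _ => cD (z t) (xx (p + 2))) _ (fun k => hw t _ (gface _ _ k (hxx _))),
        cD_const, eps_succ] at h0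
      linarith

end HC

namespace HC
open Filter Topology

/-! ### Homeomorphisms of the Cantor space -/

/-- The group. -/
abbrev HG : Type := Homeomorph CantorSpace CantorSpace

theorem hmul (f g : HG) (x : CantorSpace) : (f * g) x = f (g x) := rfl
theorem hone (x : CantorSpace) : (1 : HG) x = x := rfl
theorem hinv_self (f : HG) (x : CantorSpace) : f⁻¹ (f x) = x := f.symm_apply_apply x
theorem hself_inv (f : HG) (x : CantorSpace) : f (f⁻¹ x) = x := f.apply_symm_apply x

/-- Prepend a digit. -/
def cn (b : Bool) (x : CantorSpace) : CantorSpace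
  | 0 => b
  | n + 1 => x n

/-- Remove the first digit. -/
def tl (x : CantorSpace) : CantorSpace := fun n => x (n + 1)

@[simp] theorem cn_zero (b x) : cn b x 0 = b := rfl
@[simp] theorem cn_succ (b x) (n : ℕ) : cn b x (n + 1) = x n := rfl
@[simp] theorem cn_one (b x) : cn b x 1 = x 0 := rfl
@[simp] theorem tl_apply (x) (n : ℕ) : tl x n = x (n + 1) := rfl
@[simp] theorem tl_cn (b x) : tl (cn b x) = x := rfl
theorem cn_tl (x) : cn (x 0) (tl x) = x := by funext n; cases n <;> rfl
theorem cn_tl' {x : CantorSpace} {b} (h : x 0 = b) : cn b (tl x) = x := by rw [← h, cn_tl]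

theorem cont_cn (b) : Continuous (cn b) := by
  refine continuous_pi fun n => ?_
  cases n with
  | zero => exact continuous_const
  | succ n => exact continuous_apply n

theorem cont_tl : Continuous tl := continuous_pi fun n => continuous_apply (n + 1)

theorem cont_if {p : CantorSpace → Prop} [DecidablePred p] (hp : IsClopen {x | p x})
    {Z : Type} [TopologicalSpace Z]
    {f g : CantorSpace → Z} (hf : Continuous f) (hg : Continuous g) :
    Continuous fun x => if p x then f x else g x := by
  refine hf.if ?_ hg
  rw [hp.frontier_eq]; simp

theorem clopen_digit (n : ℕ) (b : Bool) : IsClopen {x : CantorSpace | x n = b} :=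
  (isClopen_discrete {b}).preimage (continuous_apply n)

/-- Act separately on the two halves. -/
def PF (a b : CantorSpace → CantorSpace) (x : CantorSpace) : CantorSpace :=
  if x 0 = false then cn false (a (tl x)) else cn true (b (tl x))

@[simp] theorem PF_false (a b y) : PF a b (cn false y) = cn false (a y) := by simp [PF]
@[simp] theorem PF_true (a b y) : PF a b (cn true y) = cn true (b y) := by simp [PF]

theorem cases_cn {p : CantorSpace → Prop} (h0 : ∀ y, p (cn false y)) (h1 : ∀ y, p (cn true y)) :
    ∀ x, p x := by
  intro x
  rw [← cn_tl x]
  cases x 0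
  · exact h0 _
  · exact h1 _

theorem cont_PF {a b} (ha : Continuous a) (hb : Continuous b) : Continuous (PF a b) :=
  cont_if (clopen_digit 0 false) ((cont_cn _).comp (ha.comp cont_tl))
    ((cont_cn _).comp (hb.comp cont_tl))

/-- Act separately on the two halves. -/
def PH (a b : HG) : HG where
  toFun := PF a b
  invFun := PF a.symm b.symm
  left_inv := cases_cn (fun y => by simp) (fun y => by simp)
  right_inv := cases_cn (fun y => by simp) (fun y => by simp)
  continuous_toFun := cont_PF a.continuous b.continuous
  continuous_invFun := cont_PF a.symm.continuous b.symm.continuous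

@[simp] theorem PH_false (a b y) : PH a b (cn false y) = cn false (a y) := PF_false a b y
@[simp] theorem PH_true (a b y) : PH a b (cn true y) = cn true (b y) := PF_true a b y

theorem PH_mul (a b a' b') : PH (a * a') (b * b') = PH a b * PH a' b' :=
  Homeomorph.ext (cases_cn (fun y => by simp [hmul]) (fun y => by simp [hmul]))

theorem PH_one : PH 1 1 = 1 :=
  Homeomorph.ext (cases_cn (fun y => by simp [hone]) (fun y => by simp [hone]))

/-- Act by `h` on all blocks `0^k 1 *`. -/
def JF (h : CantorSpace → CantorSpace) : CantorSpace → ℕ → Bool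
  | x, 0 => x 0
  | x, n + 1 => if x 0 = false then JF h (tl x) n else h (tl x) n

theorem JF_false (h y) : JF h (cn false y) = cn false (JF h y) := by
  funext n; cases n <;> simp [JF]

theorem JF_true (h y) : JF h (cn true y) = cn true (h y) := by
  funext n; cases n <;> simp [JF]

theorem cont_JF {h} (hh : Continuous h) : Continuous (JF h) := by
  refine continuous_pi fun n => ?_
  induction n with
  | zero => exact continuous_apply 0
  | succ n ih =>
    exact cont_if (clopen_digit 0 false) (ih.comp cont_tl)
      ((continuous_apply n).comp (hh.comp cont_tl))

theorem JF_inv {h h' : CantorSpace → CantorSpace} (hh : ∀ x, h (h' x) = x) (x : CantorSpace) :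
    JF h (JF h' x) = x := by
  funext n
  induction n generalizing x with
  | zero => rfl
  | succ n ih =>
    revert x
    refine cases_cn (fun y => ?_) (fun y => ?_)
    · rw [JF_false, JF_false]; exact ih y
    · rw [JF_true, JF_true, hh]

/-- Act by `h` on all blocks `0^k 1 *`. -/
def JH (h : HG) : HG where
  toFun := JF h
  invFun := JF h.symm
  left_inv := JF_inv (fun x => by simp)
  right_inv := JF_inv (fun x => by simp)
  continuous_toFun := cont_JF h.continuous
  continuous_invFun := cont_JF h.symm.continuous

theorem JH_eq (h : HG) : JH h = PH (JH h) h :=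
  Homeomorph.ext (cases_cn (fun y => by rw [PH_false]; exact JF_false _ _)
    (fun y => by rw [PH_true]; exact JF_true _ _))

theorem JH_mul (g h : HG) : JH (g * h) = JH g * JH h := by
  ext x n
  induction n generalizing x with
  | zero => rfl
  | succ n ih =>
    revert x
    refine cases_cn (fun y => ?_) (fun y => ?_)
    · rw [JH_eq g, JH_eq h, JH_eq (g * h), hmul, PH_false, PH_false, PH_false]
      exact ih y
    · rw [JH_eq g, JH_eq h, JH_eq (g * h), hmul, PH_true, PH_true, PH_true, hmul]

theorem JH_one : JH 1 = 1 := by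
  have := JH_mul 1 1
  rw [one_mul] at this
  exact (mul_eq_left.1 this.symm)

/-- The first homomorphism. -/
def iH : HG →* HG where
  toFun h := PH (PH 1 h) 1
  map_one' := by rw [PH_one, PH_one]
  map_mul' a b := by rw [← PH_mul, ← PH_mul, one_mul]

/-- The second homomorphism. -/
def jH : HG →* HG where
  toFun h := PH (PH (JH h) 1) 1
  map_one' := by rw [JH_one, PH_one, PH_one]
  map_mul' a b := by rw [← PH_mul, ← PH_mul, one_mul, JH_mul]

theorem iH_apply (h) : iH h = PH (PH 1 h) 1 := rfl
theorem jH_apply (h) : jH h = PH (PH (JH h) 1) 1 := rfl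

theorem iH_comm (a b) : iH a * jH b = jH b * iH a := by
  simp only [iH_apply, jH_apply, ← PH_mul, one_mul, mul_one]

theorem iH_inj : Function.Injective iH := by
  intro a b h
  ext x n
  have := congrArg (fun g : HG => g (cn false (cn true x)) (n + 2)) h
  simpa [iH_apply] using this

/-- The conjugator. -/
def rhoH : HG where
  toFun x := if x 0 = false then cn false x else if x 1 = false then cn false (cn true (tl (tl x)))
    else tl x
  invFun x := if x 0 = true then cn true x else if x 1 = false then tl x
    else cn true (cn false (tl (tl x)))
  left_inv := cases_cn (fun y => by simp)
    (fun y => by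
      revert y
      exact cases_cn (fun y => by simp) (fun y => by simp))
  right_inv := cases_cn (fun y => by
      revert y
      exact cases_cn (fun y => by simp) (fun y => by simp))
    (fun y => by simp)
  continuous_toFun := cont_if (clopen_digit 0 false) (cont_cn _)
    (cont_if (clopen_digit 1 false)
      ((cont_cn _).comp ((cont_cn _).comp (cont_tl.comp cont_tl))) cont_tl)
  continuous_invFun := cont_if (clopen_digit 0 true) (cont_cn _)
    (cont_if (clopen_digit 1 false) cont_tl
      ((cont_cn _).comp ((cont_cn _).comp (cont_tl.comp cont_tl))))

theorem rhoH_apply (x) : rhoH x = if x 0 = false then cn false x else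
    if x 1 = false then cn false (cn true (tl (tl x))) else tl x := rfl

theorem rhoH_conj (h) : rhoH * (iH h * jH h) = jH h * rhoH := by
  rw [iH_apply, jH_apply, ← PH_mul, ← PH_mul, one_mul, mul_one, one_mul, ← JH_eq]
  refine Homeomorph.ext (cases_cn (fun y => ?_) (cases_cn (fun y => ?_) (fun y => ?_)))
  · simp [hmul, rhoH_apply]
  · simp [hmul, rhoH_apply, hone]
  · simp [hmul, rhoH_apply, hone]

/-- Translation by `w`. -/
def xorH (w : CantorSpace) : HG where
  toFun x n := xor (x n) (w n)
  invFun x n := xor (x n) (w n)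
  left_inv x := by funext n; simp
  right_inv x := by funext n; simp
  continuous_toFun := continuous_pi fun n =>
    (continuous_of_discreteTopology (f := fun b => xor b (w n))).comp (continuous_apply n)
  continuous_invFun := continuous_pi fun n =>
    (continuous_of_discreteTopology (f := fun b => xor b (w n))).comp (continuous_apply n)

theorem xorH_apply (w x) (n : ℕ) : xorH w x n = xor (x n) (w n) := rfl

/-- The small support set. -/
def WW : Set CantorSpace := {x | x 0 = false ∧ x 1 = true}

theorem WW_clopen : IsClopen WW := (clopen_digit 0 false).inter (clopen_digit 1 true)

theorem iH_off (h x) (hx : x ∉ WW) : iH h x = x := by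
  revert hx
  revert x
  refine cases_cn (cases_cn (fun y => ?_) (fun y => ?_)) (fun y => ?_)
  · intro _; simp [iH_apply, hone]
  · intro h; exact absurd ⟨rfl, rfl⟩ h
  · intro _; simp [iH_apply, hone]

theorem iH_range (g : HG) (hg : ∀ x, x ∉ WW → g x = x) : ∃ h, g = iH h := by
  have hg' : ∀ x, x ∉ WW → g⁻¹ x = x := fun x hx => by
    conv_lhs => rw [← hg x hx]
    exact hinv_self _ _
  have aux : ∀ f : HG, (∀ x, x ∉ WW → f⁻¹ x = x) → ∀ y,
      cn false (cn true (tl (tl (f (cn false (cn true y)))))) = f (cn false (cn true y)) := by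
    intro f hf y
    have : f (cn false (cn true y)) ∈ WW := by
      by_contra hn
      have h2 := hf _ hn
      rw [hinv_self] at h2
      rw [← h2] at hn
      exact hn ⟨rfl, rfl⟩
    rw [cn_tl' (x := tl _) this.2, cn_tl' this.1]
  refine ⟨{ toFun := fun y => tl (tl (g (cn false (cn true y))))
            invFun := fun y => tl (tl (g⁻¹ (cn false (cn true y))))
            left_inv := fun y => by
              dsimp only
              rw [aux g hg', hinv_self]; rfl
            right_inv := fun y => by
              dsimp only
              rw [aux g⁻¹ (by rwa [inv_inv]), hself_inv]; rfl
            continuous_toFun := cont_tl.comp (cont_tl.comp (g.continuous.comp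
              ((cont_cn _).comp (cont_cn _))))
            continuous_invFun := cont_tl.comp (cont_tl.comp ((g⁻¹).continuous.comp
              ((cont_cn _).comp (cont_cn _)))) }, ?_⟩
  refine Homeomorph.ext (cases_cn (cases_cn (fun y => ?_) (fun y => ?_)) (fun y => ?_))
  · rw [iH_off, hg] <;> simp [WW]
  · rw [iH_apply, PH_false, PH_true]
    exact (aux g hg' y).symm
  · rw [iH_off, hg] <;> simp [WW]

theorem shrink (w : CantorSpace) (k : ℕ) : ∃ β : HG, ∀ x, x ∉ WW → ∀ n < k, β x n = w n := by
  have h : ∀ k, ∃ β : HG, ∀ x, x ∉ WW → ∀ n < k + 1, β x n = false := by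
    intro k
    induction k with
    | zero =>
      refine ⟨rhoH * xorH (cn true (fun _ => false)), fun x hx n hn => ?_⟩
      obtain rfl : n = 0 := by omega
      rw [hmul, rhoH_apply]
      have h0 : xorH (cn true (fun _ => false)) x 0 = ! (x 0) := by simp [xorH_apply]
      have h1 : xorH (cn true (fun _ => false)) x 1 = x 1 := by simp [xorH_apply]
      rw [h0, h1]
      simp only [WW, Set.mem_setOf_eq] at hx
      cases hx0 : x 0 <;> cases hx1 : x 1 <;> simp_all
    | succ k ih =>
      obtain ⟨β, hβ⟩ := ih
      refine ⟨rhoH * β, fun x hx n hn => ?_⟩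
      rw [hmul, rhoH_apply, if_pos (hβ x hx 0 (by omega))]
      cases n with
      | zero => rfl
      | succ n => exact hβ x hx n (by omega)
  obtain ⟨β, hβ⟩ := h k
  refine ⟨xorH w * β, fun x hx n hn => ?_⟩
  rw [hmul, xorH_apply, hβ x hx n (by omega)]; simp

theorem swap (τ : HG) (A : Set CantorSpace) (hA : IsClopen A) (hd : ∀ x ∈ A, τ x ∉ A) :
    ∃ σ : HG, (∀ x ∈ A, σ x = τ x) ∧ ∀ x, x ∉ A → τ⁻¹ x ∉ A → σ x = x := by
  classical
  let f : CantorSpace → CantorSpace := fun x => if x ∈ A then τ x else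
    if τ⁻¹ x ∈ A then τ⁻¹ x else x
  have hf : Continuous f := cont_if (p := fun x => x ∈ A) hA τ.continuous
    (cont_if (p := fun x => τ⁻¹ x ∈ A) (hA.preimage (τ⁻¹).continuous) (τ⁻¹).continuous continuous_id)
  have f1 : ∀ x, x ∈ A → f x = τ x := fun x h => if_pos h
  have f2 : ∀ x, x ∉ A → τ⁻¹ x ∈ A → f x = τ⁻¹ x := fun x h h' =>
    (if_neg h).trans (if_pos h')
  have f3 : ∀ x, x ∉ A → τ⁻¹ x ∉ A → f x = x := fun x h h' =>
    (if_neg h).trans (if_neg h')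
  have hff : ∀ x, f (f x) = x := by
    intro x
    by_cases h1 : x ∈ A
    · rw [f1 x h1, f2 _ (hd x h1) (by rw [hinv_self]; exact h1), hinv_self]
    · by_cases h2 : τ⁻¹ x ∈ A
      · rw [f2 x h1 h2, f1 _ h2, hself_inv]
      · rw [f3 x h1 h2, f3 x h1 h2]
  exact ⟨⟨⟨f, f, hff, hff⟩, hf, hf⟩, f1, f3⟩

end HC

namespace HC
open Filter Topology

/-! ### Fat points -/

/-- Base point. -/
def oo : CantorSpace := fun _ => false

theorem exists_clopen {x : CantorSpace} {V : Set CantorSpace} (hV : IsOpen V) (hx : x ∈ V) :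
    ∃ A, IsClopen A ∧ x ∈ A ∧ A ⊆ V := compact_exists_isClopen_in_isOpen hV hx

/-- Germ stabilizer of the base point. -/
def So : Subgroup HG where
  carrier := {g | ∀ᶠ z in 𝓝 oo, g z = z}
  mul_mem' := by
    intro a b ha hb
    filter_upwards [ha, hb] with z h1 h2
    rw [hmul, h2, h1]
  one_mem' := Eventually.of_forall fun _ => rfl
  inv_mem' := by
    intro a ha
    filter_upwards [ha] with z h
    conv_lhs => rw [← h]
    exact hinv_self _ _

theorem mem_So (g : HG) : g ∈ So ↔ ∀ᶠ z in 𝓝 oo, g z = z := Iff.rfl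

/-- Fat points. -/
abbrev FP : Type := HG ⧸ So

/-- The underlying point. -/
def pt : FP → CantorSpace := Quotient.lift (fun g : HG => g oo) (by
  intro a b h
  have h1 : a⁻¹ * b ∈ So := QuotientGroup.leftRel_apply.1 h
  have h2 : (a⁻¹ * b) oo = oo := h1.self_of_nhds
  rw [hmul] at h2
  show a oo = b oo
  conv_lhs => rw [← h2]
  exact hself_inv _ _)

theorem pt_mk (g : HG) : pt (QuotientGroup.mk g) = g oo := rfl

theorem pt_smul (g : HG) (x : FP) : pt (g • x) = g (pt x) := by
  induction x using QuotientGroup.induction_on with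
  | H a => rfl

theorem stab_iff (g : HG) (x : FP) : g • x = x ↔ ∀ᶠ z in 𝓝 (pt x), g z = z := by
  induction x using QuotientGroup.induction_on with
  | H a =>
    have e1 : g • (QuotientGroup.mk a : FP) = QuotientGroup.mk a ↔ a⁻¹ * (g * a) ∈ So := by
      rw [← QuotientGroup.eq]
      exact eq_comm
    rw [e1, mem_So, pt_mk, ← a.map_nhds_eq oo, eventually_map]
    refine eventually_congr (Eventually.of_forall fun z => ?_)
    rw [hmul, hmul]
    constructor
    · intro h
      conv_rhs => rw [← h]
      exact (hself_inv _ _).symm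
    · intro h; rw [h, hinv_self]

theorem smul_congr {g g' : HG} {x : FP} (h : ∀ᶠ z in 𝓝 (pt x), g z = g' z) : g • x = g' • x := by
  rw [← inv_smul_eq_iff, smul_smul, stab_iff]
  filter_upwards [h] with z hz
  rw [hmul, hz, hinv_self]

theorem pt_surj : Function.Surjective pt := by
  intro z
  refine ⟨QuotientGroup.mk (xorH z), ?_⟩
  rw [pt_mk]
  funext n
  simp [xorH_apply, oo]

theorem fp_trans (x y : FP) : ∃ g : HG, g • x = y := MulAction.exists_smul_eq HG x y

theorem cyl_nhds {x : CantorSpace} {V : Set CantorSpace} (hV : V ∈ 𝓝 x) :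
    ∀ᶠ k in atTop, ∀ z : CantorSpace, (∀ n < k, z n = x n) → z ∈ V := by
  obtain ⟨V', hV', hV'o, hxV⟩ := mem_nhds_iff.1 hV
  obtain ⟨s, ⟨y, k, rfl⟩, hs1, hs2⟩ :=
    (PiNat.isTopologicalBasis_cylinders (fun _ : ℕ => Bool)).exists_subset_of_mem_open hxV hV'o
  filter_upwards [eventually_ge_atTop k] with l hl z hz
  apply hV'
  apply hs2
  rw [PiNat.mem_cylinder_iff] at hs1 ⊢
  intro i hi
  rw [hz i (by omega), hs1 i hi]

theorem exists_ne_mem {x : CantorSpace} {V : Set CantorSpace} (hV : IsOpen V) (hx : x ∈ V) :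
    ∃ z ∈ V, z ≠ x := by
  obtain ⟨k, hk⟩ := (cyl_nhds (hV.mem_nhds hx)).exists
  refine ⟨Function.update x k (!x k), hk _ fun n hn => ?_, fun h => ?_⟩
  · simp [hn.ne]
  · have := congrFun h k
    simp at this

theorem move_ne {O : Set CantorSpace} (hO : IsOpen O) (x y : FP) (hx : pt x ∈ O) (hy : pt y ∈ O)
    (hne : pt x ≠ pt y) : ∃ (g : HG) (C : Set CantorSpace), IsClosed C ∧ C ⊆ O ∧
      (∀ z, z ∉ C → g z = z) ∧ g • x = y := by
  obtain ⟨τ, rfl⟩ := fp_trans x y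
  rw [pt_smul] at hy hne
  obtain ⟨N1, N2, o1, o2, h1, h2, hd⟩ := t2_separation hne
  obtain ⟨A, hA, hxA, hAV⟩ := exists_clopen
    (V := (O ∩ N1) ∩ τ ⁻¹' (O ∩ N2)) ((hO.inter o1).inter ((hO.inter o2).preimage τ.continuous))
    ⟨⟨hx, h1⟩, ⟨hy, h2⟩⟩
  obtain ⟨σ, hσ1, hσ2⟩ := swap τ A hA (fun z hz hz' =>
    Set.disjoint_left.1 hd (hAV hz').1.2 (hAV hz).2.2)
  refine ⟨σ, A ∪ {z | τ⁻¹ z ∈ A}, hA.1.union (hA.1.preimage (τ⁻¹).continuous), ?_, ?_, ?_⟩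
  · rintro z (hz | hz)
    · exact (hAV hz).1.1
    · have := (hAV hz).2.1
      rwa [hself_inv] at this
  · intro z hz
    rw [Set.mem_union, not_or] at hz
    exact hσ2 z hz.1 hz.2
  · apply smul_congr
    filter_upwards [hA.2.mem_nhds hxA] with z hz using hσ1 z hz

theorem move {O : Set CantorSpace} (hO : IsOpen O) (x y : FP) (hx : pt x ∈ O) (hy : pt y ∈ O) :
    ∃ (g : HG) (C : Set CantorSpace), IsClosed C ∧ C ⊆ O ∧
      (∀ z, z ∉ C → g z = z) ∧ g • x = y := by
  by_cases hne : pt x = pt y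
  · obtain ⟨z, hz, hzx⟩ := exists_ne_mem hO hx
    obtain ⟨w, rfl⟩ := pt_surj z
    obtain ⟨g, C, h1, h2, h3, h4⟩ := move_ne hO x w hx hz hzx.symm
    obtain ⟨g', C', h1', h2', h3', h4'⟩ := move_ne hO w y hz hy (by rwa [← hne])
    refine ⟨g' * g, C ∪ C', h1.union h1', Set.union_subset h2 h2', fun z hz => ?_, ?_⟩
    · rw [Set.mem_union, not_or] at hz
      rw [hmul, h3 z hz.1, h3' z hz.2]
    · rw [mul_smul, h4, h4']
  · exact move_ne hO x y hx hy hne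

/-- Generic tuples. -/
def gn (p : ℕ) (x : Fin p → FP) : Prop := Function.Injective (pt ∘ x)

theorem mem_of_off {O : Set CantorSpace} {g : HG} (hg : ∀ z, z ∉ O → g z = z) {z} (hz : z ∈ O) :
    g z ∈ O := by
  by_contra hn
  have := hg _ hn
  have := g.injective this
  rw [this] at hn
  exact hn hz

theorem cons_inj {p : ℕ} (x : FP) (xs : Fin p → FP) : gn (p + 1) (Fin.cons x xs) ↔
    pt x ∉ Set.range (pt ∘ xs) ∧ gn p xs := by
  unfold gn
  rw [← Fin.cons_injective_iff, comp_cons]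

theorem trans_in {O : Set CantorSpace} (hO : IsOpen O) (p : ℕ) (x x' : Fin p → FP) (hx : gn p x)
    (hx' : gn p x') (hxO : ∀ k, pt (x k) ∈ O) (hxO' : ∀ k, pt (x' k) ∈ O) :
    ∃ g : HG, (∀ z, z ∉ O → g z = z) ∧ g • x = x' := by
  induction p with
  | zero => exact ⟨1, fun _ _ => rfl, Subsingleton.elim _ _⟩
  | succ p ih =>
    rw [← Fin.cons_self_tail x, cons_inj] at hx
    rw [← Fin.cons_self_tail x', cons_inj] at hx'
    obtain ⟨g, hg, hgx⟩ := ih (Fin.tail x) (Fin.tail x') hx.2 hx'.2 (fun k => hxO _)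
      (fun k => hxO' _)
    have hgk : ∀ k, g • Fin.tail x k = Fin.tail x' k := fun k => congrFun hgx k
    have hfin : (Set.range (pt ∘ Fin.tail x')).Finite := Set.finite_range _
    obtain ⟨g', C, hC, hCO, hg', hgx'⟩ := move (O := O \ Set.range (pt ∘ Fin.tail x'))
      (hO.sdiff hfin.isClosed) (g • x 0) (x' 0) (by
        rw [pt_smul]
        refine ⟨mem_of_off hg (hxO 0), ?_⟩
        rintro ⟨k, hk⟩
        simp only [Function.comp] at hk
        rw [← hgk, pt_smul] at hk
        exact hx.1 ⟨k, g.injective hk⟩) ⟨hxO' 0, hx'.1⟩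
    refine ⟨g' * g, fun z hz => ?_, ?_⟩
    · rw [hmul, hg z hz, hg' z (fun h => hz (hCO h).1)]
    · funext k
      show (g' * g) • x k = x' k
      refine Fin.cases ?_ (fun k => ?_) k
      · rw [mul_smul, hgx']
      · rw [mul_smul]
        have := hgk k
        simp only [Fin.tail] at this
        rw [this, stab_iff]
        have hn : pt (x' k.succ) ∉ C := fun h => (hCO h).2 ⟨k, rfl⟩
        filter_upwards [hC.isOpen_compl.mem_nhds hn] with z hz using hg' z hz

theorem stab_seq (p : ℕ) (x : Fin (p + 1) → FP) (hx : gn (p + 1) x) : ∃ u : ℕ → HG,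
      (∀ k h, ((u k)⁻¹ * iH h * u k) • x = x) ∧
      (∀ g : HG, g • x = x → ∀ᶠ k in atTop, ∃ h, u k * g * (u k)⁻¹ = iH h) := by
  have key : ∀ k : ℕ, ∃ u : HG, (∀ l, u (pt (x l)) ∉ WW) ∧
      ∀ z, z ∉ WW → ∃ l, ∀ n < k, u⁻¹ z n = pt (x l) n := by
    intro k
    let N : Set CantorSpace := {z | ∃ l, ∀ n < k, z n = pt (x l) n}
    have hN : IsOpen N := by
      have : N = ⋃ l, PiNat.cylinder (pt (x l)) k := by
        ext z; simp [N, PiNat.mem_cylinder_iff]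
      rw [this]
      exact isOpen_iUnion fun l => PiNat.isOpen_cylinder (fun _ => Bool) _ _
    obtain ⟨β, hβ⟩ := shrink (pt (x 0)) k
    have hβN : ∀ z, z ∉ WW → β z ∈ N := fun z hz => ⟨0, hβ z hz⟩
    let e : Fin (p + 1) → CantorSpace := fun l => cn true (fun n => decide (n = l.1))
    have he : Function.Injective e := by
      intro l l' h
      have := congrFun h (l.1 + 1)
      simp [e] at this
      exact Fin.ext this
    have heW : ∀ l, e l ∉ WW := fun l h => by simpa [e] using h.1
    choose y hy using fun l => pt_surj (β (e l))
    obtain ⟨v, hv, hvx⟩ := trans_in hN (p + 1) y x (by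
        intro l l' h
        simp only [Function.comp, hy] at h
        exact he (β.injective h)) hx (fun l => by rw [hy]; exact hβN _ (heW l))
        (fun l => ⟨l, fun _ _ => rfl⟩)
    refine ⟨(v * β)⁻¹, fun l => ?_, fun z hz => ?_⟩
    · rw [← hvx]
      have : pt ((v • y) l) = (v * β) (e l) := by
        show pt (v • y l) = _
        rw [pt_smul, hy, hmul]
      rw [this, hinv_self]
      exact heW l
    · rw [inv_inv, hmul]
      exact mem_of_off hv (hβN z hz)
  choose u hu1 hu2 using key
  refine ⟨u, fun k h => ?_, fun g hg => ?_⟩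
  · funext l
    show ((u k)⁻¹ * iH h * u k) • x l = x l
    rw [stab_iff]
    have : (u k) ⁻¹' WWᶜ ∈ 𝓝 (pt (x l)) :=
      (WW_clopen.compl.isOpen.preimage (u k).continuous).mem_nhds (hu1 k l)
    filter_upwards [this] with z hz
    rw [hmul, hmul, iH_off _ _ hz, hinv_self]
  · have h1 : ∀ l, ∀ᶠ k in atTop, ∀ z : CantorSpace, (∀ n < k, z n = pt (x l) n) → g z = z := by
      intro l
      have : g • x l = x l := congrFun hg l
      rw [stab_iff] at this
      exact cyl_nhds this
    rw [← eventually_all] at h1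
    filter_upwards [h1] with k hk
    apply iH_range
    intro z hz
    obtain ⟨l, hl⟩ := hu2 k z hz
    rw [hmul, hmul, hk l _ hl, hself_inv]

theorem acyHG (m : ℕ) : Acy HG m := by
  have hK : Infinite CantorSpace := inferInstance
  have : (comap pt cofinite).NeBot := (inferInstance : (cofinite : Filter CantorSpace).NeBot).comap_of_surj pt_surj
  refine criterion gn (fun x => Function.injective_of_subsingleton _) ?_ ?_ (Ultrafilter.of (comap pt cofinite)) ?_ ?_ iH jH
    iH_comm rhoH rhoH_conj iH_inj stab_seq m
  · intro p x i hx
    exact hx.comp Fin.succAbove_right_injective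
  · intro p g x hx l l' h
    have h : pt (g • x l) = pt (g • x l') := h
    rw [pt_smul, pt_smul] at h
    exact hx (g.injective h)
  · intro p xs hxs
    have : ∀ᶠ x in comap pt cofinite, pt x ∉ Set.range (pt ∘ xs) :=
      preimage_mem_comap (Set.finite_range (pt ∘ xs)).compl_mem_cofinite
    filter_upwards [Ultrafilter.of_le _ this] with x hx
    exact (cons_inj x xs).2 ⟨hx, hxs⟩
  · intro p x x' hx hx'
    obtain ⟨g, -, hg⟩ := trans_in isOpen_univ p x x' hx hx' (fun _ => trivial) (fun _ => trivial)
    exact ⟨g, hg⟩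

end HC

/-- The group of all self-homeomorphisms of the Cantor space is boundedly acyclic. -/
theorem homeo_cantor_boundedlyAcyclic :
    BoundedlyAcyclic (Homeomorph CantorSpace CantorSpace) := by
  intro m f hb hi hc
  obtain ⟨C, hC⟩ := hb
  obtain ⟨h, ⟨C', hC'⟩, hh, hd⟩ := HC.acyHG m HC.HG (fun g y e => mul_eq_right.1 e) Unit (fun _ => f)
    ⟨C, fun _ y => hC y⟩ (fun g _ y => hi g y) (fun _ => hc)
  exact ⟨h (), ⟨C', fun x => hC' () x⟩, fun g x => hh g () x, hd ()⟩
end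

section
/- Let K be a Cantor set and z ∈ K. The rigid stabilizer G_z̄ = {g ∈ Homeo(K) : g fixes some neighborhood of z pointwise} is a binate group. -/
open Filter Topology

/-- A group `G` is binate if for every finitely generated subgroup `H ≤ G` there exist a
homomorphism `φ : H → G` and an element `s ∈ G` with `h = s⁻¹ φ(h)⁻¹ s φ(h)` for all `h ∈ H`. -/
def Binate (G : Type*) [Group G] : Prop :=
  ∀ H : Subgroup G, H.FG →
    ∃ (φ : ↥H →* G) (s : G), ∀ h : ↥H, (h : G) = s⁻¹ * (φ h)⁻¹ * s * φ h

/-- The rigid stabilizer of a point `z`: homeomorphisms fixing a neighborhood of `z`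
pointwise. -/
def rigidStabilizer (K : Type*) [TopologicalSpace K] (z : K) :
    Subgroup (Homeomorph K K) where
  carrier := {g | ∃ U ∈ 𝓝 z, ∀ x ∈ U, g x = x}
  one_mem' := ⟨Set.univ, Filter.univ_mem, fun _ _ => rfl⟩
  mul_mem' := by
    rintro a b ⟨U, hU, ha⟩ ⟨V, hV, hb⟩
    refine ⟨U ∩ V, Filter.inter_mem hU hV, fun x hx => ?_⟩
    show a (b x) = x
    rw [hb x hx.2, ha x hx.1]
  inv_mem' := by
    rintro a ⟨U, hU, ha⟩
    refine ⟨U, hU, fun x hx => ?_⟩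
    have h2 : a.symm (a x) = x := a.symm_apply_apply x
    rw [ha x hx] at h2
    exact h2

/-- Brouwer's characterization of the Cantor space. -/
theorem cantor_brouwer (X : Type*) [TopologicalSpace X] [CompactSpace X] [T2Space X]
    [TotallyDisconnectedSpace X] [SecondCountableTopology X] [Nonempty X]
    (hp : ∀ D : Set X, IsOpen D → D.Nonempty → D.Nontrivial) :
    Nonempty (X ≃ₜ (ℕ → Bool)) := by
  classical
  have hsep : ∀ x y : X, x ≠ y → ∃ U : Set X, IsClopen U ∧ x ∈ U ∧ y ∉ U := by
    intro x y hxy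
    obtain ⟨U, hU, hx, hy⟩ := exists_isClopen_of_totally_separated hxy
    exact ⟨U, hU, hx, hy⟩
  have hcount : Countable (TopologicalSpace.Clopens X) :=
    TopologicalSpace.Clopens.countable_iff_secondCountable.mpr inferInstance
  obtain ⟨C, hC⟩ := exists_surjective_nat (TopologicalSpace.Clopens X)
  have hsplit : ∀ (n : ℕ) (D : Set X), ∃ P : Set X, IsClopen D → D.Nonempty →
      IsClopen P ∧ (D ∩ P).Nonempty ∧ (D \ P).Nonempty ∧
      ∀ x ∈ D, ∀ y ∈ D, (x ∈ P ↔ y ∈ P) → (x ∈ C n ↔ y ∈ C n) := by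
    intro n D
    by_cases hD : IsClopen D ∧ D.Nonempty
    swap
    · exact ⟨∅, fun h1 h2 => absurd ⟨h1, h2⟩ hD⟩
    obtain ⟨hD1, hD2⟩ := hD
    by_cases h : (D ∩ C n).Nonempty ∧ (D \ C n).Nonempty
    · exact ⟨C n, fun _ _ => ⟨(C n).isClopen, h.1, h.2, fun x _ y _ hxy => hxy⟩⟩
    · obtain ⟨a, ha, b, hb, hab⟩ := hp D hD1.isOpen hD2
      obtain ⟨U, hU, haU, hbU⟩ := hsep a b hab
      refine ⟨U, fun _ _ => ⟨hU, ⟨a, ha, haU⟩, ⟨b, hb, hbU⟩, fun x hx y hy _ => ?_⟩⟩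
      by_cases hxC : x ∈ C n <;> by_cases hyC : y ∈ C n
      · simp [hxC, hyC]
      · exact absurd ⟨⟨x, hx, hxC⟩, ⟨y, hy, hyC⟩⟩ h
      · exact absurd ⟨⟨y, hy, hyC⟩, ⟨x, hx, hxC⟩⟩ h
      · simp [hxC, hyC]
  choose P hP using hsplit
  let cell : (ℕ → Bool) → ℕ → Set X := fun a n =>
    Nat.rec Set.univ (fun k D => if a k = true then D ∩ P k D else D \ P k D) n
  have cell_succ : ∀ a n, cell a (n + 1) =
      if a n = true then cell a n ∩ P n (cell a n) else cell a n \ P n (cell a n) :=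
    fun a n => rfl
  have cell_good : ∀ a n, IsClopen (cell a n) ∧ (cell a n).Nonempty := by
    intro a n
    induction n with
    | zero => exact ⟨isClopen_univ, Set.univ_nonempty⟩
    | succ k ih =>
      obtain ⟨h1, h2, h3, _⟩ := hP k _ ih.1 ih.2
      rw [cell_succ]
      split_ifs
      · exact ⟨ih.1.inter h1, h2⟩
      · exact ⟨ih.1.diff h1, h3⟩
  let cx : X → ℕ → Set X := fun x n =>
    Nat.rec Set.univ (fun k D => if x ∈ P k D then D ∩ P k D else D \ P k D) n
  have cx_succ : ∀ x n, cx x (n + 1) =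
      if x ∈ P n (cx x n) then cx x n ∩ P n (cx x n) else cx x n \ P n (cx x n) :=
    fun x n => rfl
  let f : X → (ℕ → Bool) := fun x n => decide (x ∈ P n (cx x n))
  have hf : ∀ x n, f x n = decide (x ∈ P n (cx x n)) := fun x n => rfl
  have cx_cell : ∀ x n, cx x n = cell (f x) n := by
    intro x n
    induction n with
    | zero => rfl
    | succ k ih => rw [cx_succ, cell_succ, hf, ← ih]; simp
  have mem_cx : ∀ x n, x ∈ cx x n := by
    intro x n
    induction n with
    | zero => exact Set.mem_univ x
    | succ k ih =>
      rw [cx_succ]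
      split_ifs with h
      · exact ⟨ih, h⟩
      · exact ⟨ih, h⟩
  have cx_eq : ∀ x y n, y ∈ cx x n → cx y n = cx x n := by
    intro x y n
    induction n with
    | zero => intro _; rfl
    | succ k ih =>
      intro hy
      rw [cx_succ] at hy
      rw [cx_succ, cx_succ]
      split_ifs at hy with h
      · rw [ih hy.1, if_pos hy.2, if_pos h]
      · rw [ih hy.1, if_neg hy.2, if_neg h]
  have f_eq : ∀ x y n, y ∈ cx x (n + 1) → f y n = f x n := by
    intro x y n hy
    rw [cx_succ] at hy
    rw [hf, hf]
    split_ifs at hy with h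
    · rw [cx_eq x y n hy.1]; simp [h, hy.2]
    · rw [cx_eq x y n hy.1]; simp [h, hy.2]
  have f_cont : Continuous f := by
    refine continuous_pi fun n => ?_
    refine IsLocallyConstant.continuous ?_
    rw [IsLocallyConstant.iff_exists_open]
    intro x
    refine ⟨cx x (n + 1), ?_, mem_cx x (n + 1), fun y hy => f_eq x y n hy⟩
    rw [cx_cell x (n + 1)]
    exact (cell_good (f x) (n + 1)).1.isOpen
  have f_inj : Function.Injective f := by
    intro x y hxy
    by_contra hne
    obtain ⟨U, hU, hxU, hyU⟩ := hsep x y hne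
    obtain ⟨n, hn⟩ := hC ⟨U, hU⟩
    have hc : cx y n = cx x n := by rw [cx_cell, cx_cell, hxy]
    have hg := cell_good (f x) n
    rw [← cx_cell] at hg
    have h4 := (hP n _ hg.1 hg.2).2.2.2 x (mem_cx x n) y (hc ▸ mem_cx y n)
    have h5 : f x n = f y n := by rw [hxy]
    rw [hf, hf, hc, decide_eq_decide] at h5
    have h6 := h4 h5
    rw [hn] at h6
    exact hyU (h6.1 hxU)
  have f_surj : Function.Surjective f := by
    intro a
    have hne : (⋂ n, cell a n).Nonempty := by
      apply IsCompact.nonempty_iInter_of_sequence_nonempty_isCompact_isClosed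
      · intro n
        rw [cell_succ]
        split_ifs
        · exact Set.inter_subset_left
        · exact Set.sdiff_subset
      · exact fun n => (cell_good a n).2
      · exact (cell_good a 0).1.isClosed.isCompact
      · exact fun n => (cell_good a n).1.isClosed
    obtain ⟨x, hx⟩ := hne
    rw [Set.mem_iInter] at hx
    have key : ∀ n, cx x n = cell a n → f x n = a n := by
      intro n hn
      have := hx (n + 1)
      rw [cell_succ] at this
      rw [hf, hn]
      split_ifs at this with h
      · simp [h, this.2]
      · simp [h, this.2]
    have key2 : ∀ n, cx x n = cell a n := by
      intro n
      induction n with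
      | zero => rfl
      | succ k ih =>
        have h1 := key k ih
        rw [cx_succ, cell_succ, ← h1, hf, ← ih]
        simp
    exact ⟨x, funext fun n => key n (key2 n)⟩
  exact ⟨f_cont.homeoOfEquivCompactToT2 (f := Equiv.ofBijective f ⟨f_inj, f_surj⟩)⟩

theorem clopen_homeo_cantor {K : Type*} [TopologicalSpace K] [CompactSpace K]
    [TopologicalSpace.MetrizableSpace K] [TotallyDisconnectedSpace K]
    (hperf : ∀ x : K, (𝓝[≠] x).NeBot) (S : Set K) (hS : IsClopen S) (hne : S.Nonempty) :
    Nonempty (S ≃ₜ (ℕ → Bool)) := by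
  have : CompactSpace S := isCompact_iff_compactSpace.mp hS.isClosed.isCompact
  have : Nonempty S := hne.to_subtype
  let _ : MetricSpace K := TopologicalSpace.metrizableSpaceMetric K
  apply cantor_brouwer
  rintro D hD ⟨x, hx⟩
  have h1 : IsOpen (Subtype.val '' D : Set K) := hS.isOpen.isOpenMap_subtype_val D hD
  have h2 : (Subtype.val '' D : Set K) ∈ 𝓝 (x : K) := h1.mem_nhds ⟨x, hx, rfl⟩
  have := hperf (x : K)
  have h3 : (Subtype.val '' D : Set K) ∩ {(x : K)}ᶜ ∈ 𝓝[≠] (x : K) :=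
    inter_mem (mem_nhdsWithin_of_mem_nhds h2) self_mem_nhdsWithin
  obtain ⟨y, ⟨d, hd, hdy⟩, hy⟩ := Filter.nonempty_of_mem h3
  refine ⟨x, hx, d, hd, ?_⟩
  rintro rfl
  exact hy hdy.symm

/-- Decomposition of a Cantor set `W` minus a point into countably many clopen pieces. -/
theorem exists_pieces {K : Type*} [TopologicalSpace K] [CompactSpace K]
    [TopologicalSpace.MetrizableSpace K] [TotallyDisconnectedSpace K]
    (hperf : ∀ x : K, (𝓝[≠] x).NeBot) (S : Set K) (hS : IsClopen S) (hne : S.Nonempty) :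
    ∃ (p : K) (D : ℕ → Set K), p ∈ S ∧ (∀ n, IsClopen (D n)) ∧ (∀ n, (D n).Nonempty) ∧
      (∀ n m x, x ∈ D n → x ∈ D m → n = m) ∧ (⋃ n, D n) = S \ {p} := by
  obtain ⟨w⟩ := clopen_homeo_cantor hperf S hS hne
  let Z : ℕ → Set (ℕ → Bool) := fun n => {c | c n = true ∧ ∀ i < n, c i = false}
  have hZ : ∀ n, IsClopen (Z n) := by
    intro n
    have h1 : ∀ (i : ℕ) (b : Bool), IsClopen {c : ℕ → Bool | c i = b} := fun i b =>
      (isClopen_discrete {b}).preimage (continuous_apply i)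
    have : Z n = {c | c n = true} ∩ ⋂ i ∈ Finset.range n, {c | c i = false} := by
      ext c; simp [Z]
    rw [this]
    exact (h1 n true).inter (isClopen_biInter_finset fun i _ => h1 i false)
  refine ⟨w.symm (fun _ => false), fun n => Subtype.val '' (w ⁻¹' Z n), (w.symm _).2, ?_, ?_, ?_, ?_⟩
  · intro n
    have := (hZ n).preimage w.continuous
    exact ⟨hS.isClosed.isClosedEmbedding_subtypeVal.isClosedMap _ this.isClosed,
      hS.isOpen.isOpenMap_subtype_val _ this.isOpen⟩
  · intro n
    refine ⟨w.symm (fun i => decide (i = n)), w.symm _, ?_, rfl⟩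
    simp only [Set.mem_preimage, Homeomorph.apply_symm_apply, Z, Set.mem_ofPred_eq]
    refine ⟨by simp, fun i hi => by simp; omega⟩
  · rintro n m x ⟨a, ha, rfl⟩ ⟨b, hb, hab⟩
    obtain rfl := Subtype.ext hab
    rcases lt_trichotomy n m with h | h | h
    · have := hb.2 n h
      rw [ha.1] at this; cases this
    · exact h
    · have := ha.2 m h
      rw [hb.1] at this; cases this
  · ext x
    simp only [Set.mem_iUnion, Set.mem_sdiff, Set.mem_singleton_iff]
    constructor
    · rintro ⟨n, a, ha, rfl⟩
      refine ⟨a.2, fun h => ?_⟩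
      have h2 := Subtype.ext h
      subst h2
      have := ha.1
      simp at this
    · rintro ⟨hx, hne⟩
      have hex : ∃ n, w ⟨x, hx⟩ n = true := by
        by_contra hcon
        push Not at hcon
        apply hne
        have : w ⟨x, hx⟩ = fun _ => false := funext fun n => by simpa using hcon n
        rw [← this]; simp
      classical
      refine ⟨Nat.find hex, ⟨x, hx⟩, ⟨Nat.find_spec hex, fun i hi => ?_⟩, rfl⟩
      simpa using Nat.find_min hex hi

/-- The basic extension: homeomorphisms of `ℤ × A` extend to `K`, fixing a neighbourhood of
`V`. -/
theorem exists_extension {K : Type*} [TopologicalSpace K] [CompactSpace K]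
    [TopologicalSpace.MetrizableSpace K] [TotallyDisconnectedSpace K]
    (hperf : ∀ x : K, (𝓝[≠] x).NeBot) (A W V : Set K) (hA : IsClopen A) (hAne : A.Nonempty)
    (hW : IsClopen W) (hWne : W.Nonempty) (hV : IsClopen V) (hAW : Disjoint A W)
    (hV' : Vᶜ = A ∪ W) :
    ∃ (j : ℤ × A → K) (T : (ℤ × A ≃ₜ ℤ × A) → (K ≃ₜ K)),
      Function.Injective j ∧ (∀ a : A, j (0, a) = a) ∧ (∀ y, j y ∉ V) ∧
      (∀ g y, T g (j y) = j (g y)) ∧ (∀ g x, x ∉ Set.range j → T g x = x) := by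
  classical
  let _ : MetricSpace K := TopologicalSpace.metrizableSpaceMetric K
  obtain ⟨p, D, hpW, hDc, hDne, hDdisj, hDun⟩ := exists_pieces hperf W hW hWne
  obtain ⟨α⟩ := clopen_homeo_cantor hperf A hA hAne
  have hβ : ∀ n, Nonempty (A ≃ₜ D n) := fun n => by
    obtain ⟨δ⟩ := clopen_homeo_cantor hperf (D n) (hDc n) (hDne n)
    exact ⟨α.trans δ.symm⟩
  have β := fun n => (hβ n).some
  have hDW : ∀ n, D n ⊆ W := fun n x hx =>
    ((Set.ext_iff.mp hDun x).mp (Set.mem_iUnion.mpr ⟨n, hx⟩)).1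
  have hDp : ∀ n, p ∉ D n := fun n hx =>
    ((Set.ext_iff.mp hDun p).mp (Set.mem_iUnion.mpr ⟨n, hx⟩)).2 rfl
  have hnA : ∀ (a : A), (a : K) ∉ W := fun a h => Set.disjoint_left.mp hAW a.2 h
  obtain ⟨enc⟩ : Nonempty ({n : ℤ // n ≠ 0} ≃ ℕ) := by
    have : Infinite {n : ℤ // n ≠ 0} :=
      Infinite.of_injective (fun n : ℕ => (⟨(n : ℤ) + 1, by omega⟩ : {n : ℤ // n ≠ 0}))
        (fun a b h => by simpa using h)
    exact nonempty_equiv_of_countable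
  let j : ℤ × A → K := fun y => if h : y.1 = 0 then (y.2 : K) else (β (enc ⟨y.1, h⟩) y.2 : K)
  have j0 : ∀ a : A, j (0, a) = a := fun a => by simp [j]
  have jn : ∀ n (h : n ≠ 0) (a : A), j (n, a) = β (enc ⟨n, h⟩) a := fun n h a => by simp [j, h]
  have jcont : Continuous j := by
    rw [continuous_prod_of_discrete_left]
    intro n
    by_cases h : n = 0
    · subst h
      simp only [j0]; exact continuous_subtype_val
    · simp only [jn n h]
      exact continuous_subtype_val.comp (β _).continuous
  have jopen : IsOpenMap j := by
    rw [isOpenMap_prod_of_discrete_left]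
    intro n
    by_cases h : n = 0
    · subst h
      simp only [j0]; exact hA.isOpen.isOpenMap_subtype_val
    · simp only [jn n h]
      exact (hDc _).isOpen.isOpenMap_subtype_val.comp (β _).isOpenMap
  have jinj : Function.Injective j := by
    rintro ⟨n, a⟩ ⟨m, b⟩ h
    by_cases hn : n = 0 <;> by_cases hm : m = 0
    · subst hn hm
      rw [j0, j0] at h
      rw [Subtype.ext h]
    · subst hn
      rw [j0, jn m hm] at h
      exact absurd (h ▸ hDW _ (β _ b).2) (hnA a)
    · subst hm
      rw [j0, jn n hn] at h
      exact absurd (h ▸ hDW _ (β _ a).2) (hnA b)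
    · rw [jn n hn, jn m hm] at h
      have h1 := hDdisj _ _ _ (β (enc ⟨n, hn⟩) a).2 (h ▸ (β (enc ⟨m, hm⟩) b).2)
      have h2 := congrArg Subtype.val (enc.injective h1)
      simp only at h2
      subst h2
      rw [(β _).injective (Subtype.ext h)]
  have jV : ∀ y, j y ∈ Vᶜ := by
    rintro ⟨n, a⟩
    rw [hV']
    by_cases hn : n = 0
    · subst hn; rw [j0]; exact Or.inl a.2
    · rw [jn n hn]; exact Or.inr (hDW _ (β _ a).2)
  have jp : ∀ y, j y ≠ p := by
    rintro ⟨n, a⟩ h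
    by_cases hn : n = 0
    · subst hn; rw [j0] at h; exact hnA a (h ▸ hpW)
    · rw [jn n hn] at h; exact hDp _ (h ▸ (β _ a).2)
  have jsurj : ∀ x ∈ Vᶜ, x ≠ p → ∃ y, j y = x := by
    intro x hx hxp
    rw [hV'] at hx
    rcases hx with hx | hx
    · exact ⟨(0, ⟨x, hx⟩), j0 _⟩
    · obtain ⟨k, hk⟩ := Set.mem_iUnion.mp ((Set.ext_iff.mp hDun x).mpr ⟨hx, hxp⟩)
      refine ⟨((enc.symm k).1, (β k).symm ⟨x, hk⟩), ?_⟩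
      rw [jn _ (enc.symm k).2]
      have : enc ⟨(enc.symm k).1, (enc.symm k).2⟩ = k := enc.apply_symm_apply k
      rw [this]; simp
  have hpV : p ∈ Vᶜ := by rw [hV']; exact Or.inr hpW
  let B : Set K := Vᶜ
  have hB : IsClopen B := hV.compl
  have : CompactSpace B := isCompact_iff_compactSpace.mp hB.isClosed.isCompact
  have : CompactSpace V := isCompact_iff_compactSpace.mp hV.isClosed.isCompact
  let jB : ℤ × A → B := fun y => ⟨j y, jV y⟩
  have jBemb : IsEmbedding jB := by
    have : IsEmbedding (Subtype.val ∘ jB) :=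
      (IsOpenEmbedding.of_continuous_injective_isOpenMap jcont jinj jopen).isEmbedding
    exact (IsEmbedding.of_comp_iff IsEmbedding.subtypeVal).mp this
  have jBrange : Set.range jB = {(⟨p, hpV⟩ : B)}ᶜ := by
    ext x
    simp only [Set.mem_range, Set.mem_compl_iff, Set.mem_singleton_iff]
    constructor
    · rintro ⟨y, rfl⟩ h
      exact jp y (congrArg Subtype.val h)
    · intro h
      obtain ⟨y, hy⟩ := jsurj x.1 x.2 (fun h' => h (Subtype.ext h'))
      exact ⟨y, Subtype.ext hy⟩
  let eB : OnePoint (ℤ × A) ≃ₜ B := OnePoint.equivOfIsEmbeddingOfRangeEq _ jB jBemb jBrange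
  let F : OnePoint (ℤ × A) ⊕ V → K := Sum.elim (fun t => (eB t : K)) (fun v => (v : K))
  have Fcont : Continuous F :=
    (continuous_subtype_val.comp eB.continuous).sumElim continuous_subtype_val
  have Fbij : Function.Bijective F := by
    constructor
    · rintro (s | s) (t | t) h
      · rw [eB.injective (Subtype.ext h)]
      · exact absurd t.2 (by have := (eB s).2; simp only [F, Sum.elim_inl, Sum.elim_inr] at h; rwa [h] at this)
      · exact absurd s.2 (by have := (eB t).2; simp only [F, Sum.elim_inl, Sum.elim_inr] at h; rwa [← h] at this)
      · rw [Subtype.ext h]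
    · intro x
      by_cases hx : x ∈ V
      · exact ⟨Sum.inr ⟨x, hx⟩, rfl⟩
      · exact ⟨Sum.inl (eB.symm ⟨x, hx⟩), by simp [F]⟩
  let E : OnePoint (ℤ × A) ⊕ V ≃ₜ K :=
    Fcont.homeoOfEquivCompactToT2 (f := Equiv.ofBijective F Fbij)
  have Ej : ∀ y : ℤ × A, E (Sum.inl (y : OnePoint (ℤ × A))) = j y := fun y => rfl
  have Ep : E (Sum.inl OnePoint.infty) = p := rfl
  have Ev : ∀ v : V, E (Sum.inr v) = v := fun v => rfl
  refine ⟨j, fun g => E.symm.trans ((Homeomorph.sumCongr g.onePointCongr (Homeomorph.refl V)).trans E),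
    jinj, j0, jV, ?_, ?_⟩
  · intro g y
    rw [← Ej y, ← Ej (g y)]
    simp
    rfl
  · intro g x hx
    by_cases hxV : x ∈ V
    · have := Ev ⟨x, hxV⟩
      simp only at this
      rw [← this]; simp; rfl
    · have : x = p := by
        by_contra h
        exact hx (jsurj x hxV h)
      rw [this, ← Ep]; simp; rfl

/-- Apply `r` on the blocks with nonnegative index. -/
def blockHomeo {A : Type*} [TopologicalSpace A] (r : A ≃ₜ A) : ℤ × A ≃ₜ ℤ × A where
  toFun y := if 0 ≤ y.1 then (y.1, r y.2) else y
  invFun y := if 0 ≤ y.1 then (y.1, r.symm y.2) else y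
  left_inv y := by by_cases h : 0 ≤ y.1 <;> simp [h]
  right_inv y := by by_cases h : 0 ≤ y.1 <;> simp [h]
  continuous_toFun := by
    rw [continuous_prod_of_discrete_left]
    intro n
    by_cases h : 0 ≤ n <;> simp only [h, if_true, if_false] <;> fun_prop
  continuous_invFun := by
    rw [continuous_prod_of_discrete_left]
    intro n
    by_cases h : 0 ≤ n <;> simp only [h, if_true, if_false] <;> fun_prop

/-- Shift of the blocks. -/
def shiftHomeo (A : Type*) [TopologicalSpace A] : ℤ × A ≃ₜ ℤ × A where
  toFun y := (y.1 - 1, y.2)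
  invFun y := (y.1 + 1, y.2)
  left_inv y := by simp
  right_inv y := by simp
  continuous_toFun := by fun_prop
  continuous_invFun := by fun_prop

theorem exists_common_nhd {K : Type*} [TopologicalSpace K] (z : K)
    (H : Subgroup (rigidStabilizer K z)) (hH : H.FG) :
    ∃ U ∈ 𝓝 z, ∀ h ∈ H, ∀ x ∈ U, h.1 x = x := by
  obtain ⟨S, rfl⟩ := hH
  choose N hN hN' using fun g : rigidStabilizer K z => g.2
  refine ⟨⋂ g ∈ S, N g, (Filter.biInter_finset_mem S).mpr fun g _ => hN g, fun h hh => ?_⟩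
  induction hh using Subgroup.closure_induction with
  | mem g hg =>
    intro x hx
    exact hN' g x (Set.mem_iInter₂.mp hx g hg)
  | one => intro x _; rfl
  | mul a b _ _ iha ihb =>
    intro x hx
    change a.1 (b.1 x) = x
    rw [ihb x hx, iha x hx]
  | inv a _ iha =>
    intro x hx
    change a.1.symm x = x
    rw [Homeomorph.symm_apply_eq, iha x hx]

/-- For a Cantor set `K` (nonempty, compact, metrizable, totally disconnected, perfect)
and a point `z ∈ K`, the rigid stabilizer of `z` in `Homeo(K)` is a binate group. -/
theorem rigidStabilizer_binate (K : Type*) [TopologicalSpace K] [CompactSpace K]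
    [TopologicalSpace.MetrizableSpace K] [TotallyDisconnectedSpace K] [Nonempty K]
    (hperf : ∀ x : K, (𝓝[≠] x).NeBot) (z : K) :
    Binate ↥(rigidStabilizer K z) := by
  classical
  intro H hH
  obtain ⟨U₀, hU₀, hfix₀⟩ := exists_common_nhd z H hH
  let _ : MetricSpace K := TopologicalSpace.metrizableSpaceMetric K
  have shrink : ∀ N ∈ 𝓝 z, ∃ (U : Set K) (y : K), IsClopen U ∧ z ∈ U ∧ U ⊆ N ∧ y ∈ N ∧ y ∉ U := by
    intro N hN
    have := hperf z
    obtain ⟨y, hyN, hyz⟩ := Filter.nonempty_of_mem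
      (inter_mem (mem_nhdsWithin_of_mem_nhds hN) (self_mem_nhdsWithin : {z}ᶜ ∈ 𝓝[≠] z))
    have h1 : N ∩ {y}ᶜ ∈ 𝓝 z :=
      inter_mem hN (isOpen_compl_singleton.mem_nhds (fun h => hyz h.symm))
    obtain ⟨O, hO, hOo, hzO⟩ := mem_nhds_iff.mp h1
    obtain ⟨U, hU, hzU, hUO⟩ := compact_exists_isClopen_in_isOpen hOo hzO
    exact ⟨U, y, hU, hzU, fun x hx => (hO (hUO hx)).1, hyN, fun h => (hO (hUO h)).2 rfl⟩
  obtain ⟨U, y, hU, hzU, hUU₀, -, hyU⟩ := shrink U₀ hU₀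
  obtain ⟨V, y', hV, hzV, hVU, hy'U, hy'V⟩ := shrink U (hU.isOpen.mem_nhds hzU)
  have hfix : ∀ h ∈ H, ∀ x ∈ U, h.1 x = x := fun h hh x hx => hfix₀ h hh x (hUU₀ hx)
  have hdisj : Disjoint Uᶜ (U \ V) := Set.disjoint_left.mpr fun x hx hx' => hx hx'.1
  have hcover : Vᶜ = Uᶜ ∪ (U \ V) := by
    ext x
    have := @hVU x
    simp only [Set.mem_compl_iff, Set.mem_union, Set.mem_sdiff]
    tauto
  obtain ⟨j, T, jinj, j0, jV, Tj, Tfix⟩ := exists_extension hperf Uᶜ (U \ V) V hU.compl ⟨y, hyU⟩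
    (hU.diff hV) ⟨y', hy'U, hy'V⟩ hV hdisj hcover
  have hTmem : ∀ g, T g ∈ rigidStabilizer K z := fun g =>
    ⟨V, hV.isOpen.mem_nhds hzV, fun x hx => Tfix g x (by rintro ⟨w, rfl⟩; exact jV w hx)⟩
  have hinv : ∀ h : H, ∀ x, x ∈ Uᶜ ↔ h.1.1 x ∈ Uᶜ := by
    intro h x
    rw [not_iff_not.symm]
    simp only [Set.mem_compl_iff, not_not]
    constructor
    · intro hx; rw [hfix h.1 h.2 x hx]; exact hx
    · intro hx
      have := h.1.1.injective (hfix h.1 h.2 _ hx)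
      rwa [this] at hx
  let r : H → ((Uᶜ : Set K) ≃ₜ (Uᶜ : Set K)) := fun h => h.1.1.subtype (hinv h)
  have hr : ∀ h a, ((r h a : (Uᶜ : Set K)) : K) = h.1.1 a := fun h a => rfl
  have hrmul : ∀ h k a, r (h * k) a = r h (r k a) := fun h k a => rfl
  have block_pos : ∀ h (n : ℤ) a, 0 ≤ n → blockHomeo (r h) (n, a) = (n, r h a) := by
    intro h n a hn; simp [blockHomeo, hn]
  have block_neg : ∀ h (n : ℤ) a, ¬ 0 ≤ n → blockHomeo (r h) (n, a) = (n, a) := by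
    intro h n a hn; simp [blockHomeo, hn]
  have shift_apply : ∀ (n : ℤ) a, shiftHomeo (Uᶜ : Set K) (n, a) = (n - 1, a) := fun _ _ => rfl
  let φ : H →* rigidStabilizer K z := MonoidHom.mk'
    (fun h => ⟨T (blockHomeo (r h)), hTmem _⟩) (by
      intro h k
      apply Subtype.ext
      apply Homeomorph.ext
      intro x
      change T (blockHomeo (r (h * k))) x = T (blockHomeo (r h)) (T (blockHomeo (r k)) x)
      by_cases hx : x ∈ Set.range j
      · obtain ⟨⟨n, a⟩, rfl⟩ := hx
        rw [Tj, Tj, Tj]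
        by_cases hn : 0 ≤ n
        · rw [block_pos _ _ _ hn, block_pos _ _ _ hn, block_pos _ _ _ hn, hrmul]
        · rw [block_neg _ _ _ hn, block_neg _ _ _ hn, block_neg _ _ _ hn]
      · rw [Tfix _ x hx, Tfix _ x hx, Tfix _ x hx])
  let s : rigidStabilizer K z := ⟨T (shiftHomeo _), hTmem _⟩
  refine ⟨φ, s, fun h => ?_⟩
  have key : φ h * s * h.1 = s * φ h := by
    apply Subtype.ext
    apply Homeomorph.ext
    intro x
    change T (blockHomeo (r h)) (T (shiftHomeo _) (h.1.1 x)) =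
      T (shiftHomeo _) (T (blockHomeo (r h)) x)
    by_cases hx : x ∈ Set.range j
    · obtain ⟨⟨n, a⟩, rfl⟩ := hx
      by_cases hn : n = 0
      · subst hn
        rw [Tj, block_pos _ _ _ le_rfl, Tj, j0, ← hr, ← j0, Tj, shift_apply, Tj,
          block_neg _ _ _ (by norm_num)]
      · have hjU : j (n, a) ∈ U := by
          by_contra hcon
          have h1 := jinj (j0 ⟨j (n, a), hcon⟩)
          exact hn (congrArg Prod.fst h1).symm
        rw [hfix h.1 h.2 _ hjU, Tj, Tj, Tj, Tj, shift_apply]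
        by_cases hn' : 0 ≤ n
        · rw [block_pos _ _ _ hn', block_pos _ _ _ (by omega), shift_apply]
        · rw [block_neg _ _ _ hn', block_neg _ _ _ (by omega), shift_apply]
    · have hxU : x ∈ U := by
        by_contra hcon
        exact hx ⟨(0, ⟨x, hcon⟩), j0 _⟩
      rw [hfix h.1 h.2 _ hxU, Tfix _ x hx, Tfix _ x hx, Tfix _ x hx]
  calc (h : rigidStabilizer K z) = s⁻¹ * (φ h)⁻¹ * (φ h * s * h.1) := by group
    _ = s⁻¹ * (φ h)⁻¹ * s * φ h := by rw [key]; group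
end

section
/- Every finitely generated binate group is trivial; equivalently, no nontrivial finitely generated group is binate. -/
/-- Every finitely generated binate group is trivial. -/
theorem binate_fg_trivial {G : Type*} [Group G] (hfg : Group.FG G) (hb : Binate G) :
    ∀ g : G, g = 1 := by
  obtain ⟨φ, s, h⟩ := hb ⊤ ((Group.fg_def).1 hfg)
  -- the conjugate of `φ` by `s` satisfies `ψ x * x = φ x`
  have e : ∀ x : (⊤ : Subgroup G), s⁻¹ * φ x * s * (x : G) = φ x := by
    intro x
    rw [h x]
    group
  -- hence the values of `ψ` are central
  have c : ∀ x y : (⊤ : Subgroup G),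
      (s⁻¹ * φ y * s) * (x : G) = (x : G) * (s⁻¹ * φ y * s) := by
    intro x y
    have h1 := e (x * y)
    rw [map_mul, Subgroup.coe_mul] at h1
    have h2 : s⁻¹ * (φ x * φ y) * s * ((x : G) * y)
        = (s⁻¹ * φ x * s) * ((s⁻¹ * φ y * s) * (x : G)) * y := by group
    have h3 : φ x * φ y
        = (s⁻¹ * φ x * s) * ((x : G) * (s⁻¹ * φ y * s)) * y := by
      conv_lhs => rw [← e x, ← e y]
      group
    rw [h2, h3] at h1
    exact mul_left_cancel (mul_right_cancel h1)
  intro g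
  have h1 := c ⟨s, trivial⟩ ⟨g, trivial⟩
  have h2 := e ⟨g, trivial⟩
  simp only at h1 h2
  have h3 : s⁻¹ * φ ⟨g, trivial⟩ * s = φ ⟨g, trivial⟩ := by
    have h4 : s * (s⁻¹ * φ ⟨g, trivial⟩ * s) = φ ⟨g, trivial⟩ * s := by group
    rw [h4] at h1
    exact mul_right_cancel h1
  rw [h3] at h2
  exact mul_eq_left.1 h2
end

section
/- Let G be an amenable group, W a real normed vector space equipped with an action of G by linear isometries, and V = W* its topological dual endowed with the dual action (g·ψ)(w) = ψ(g⁻¹·w). Then for every n ≥ 1, every G-invariant bounded function f : G^{n+1} → V satisfying δⁿ f = 0 is of the form δ^{n−1} h for some G-invariant bounded function h : Gⁿ → V. In particular (taking W = ℝ with trivial action), amenable groups are boundedly acyclic. -/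
/-- A mean on `ℓ∞(X)`: a linear functional on the bounded real-valued functions on `X`
with `m(1) = 1` and `m(f) ≥ 0` whenever `f ≥ 0`.  (The value of `app` on unbounded
functions is irrelevant.) -/
structure Mean (X : Type*) where
  app : (X → ℝ) → ℝ
  map_add : ∀ f g : X → ℝ, BddFn f → BddFn g → app (f + g) = app f + app g
  map_smul : ∀ (c : ℝ) (f : X → ℝ), BddFn f → app (c • f) = c * app f
  map_one : app (fun _ => 1) = 1
  nonneg : ∀ f : X → ℝ, BddFn f → (∀ x, 0 ≤ f x) → 0 ≤ app f

/-- A group is amenable if it admits a left-invariant mean on `ℓ∞(G)`. -/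
def Amenable (G : Type*) [Group G] : Prop :=
  ∃ m : Mean G, ∀ (g : G) (f : G → ℝ), BddFn f →
    m.app (fun x => f (g⁻¹ * x)) = m.app f

theorem BddFn.add' {α : Type*} {f g : α → ℝ} (hf : BddFn f) (hg : BddFn g) : BddFn (f + g) := by
  obtain ⟨C, hC⟩ := hf
  obtain ⟨D, hD⟩ := hg
  exact ⟨C + D, fun x => (abs_add_le _ _).trans (add_le_add (hC x) (hD x))⟩

theorem BddFn.smul' {α : Type*} {f : α → ℝ} (c : ℝ) (hf : BddFn f) : BddFn (c • f) := by
  obtain ⟨C, hC⟩ := hf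
  refine ⟨|c| * C, fun x => ?_⟩
  simp only [Pi.smul_apply, smul_eq_mul, abs_mul]
  exact mul_le_mul_of_nonneg_left (hC x) (abs_nonneg c)

theorem bddFn_const {α : Type*} (c : ℝ) : BddFn (fun _ : α => c) := ⟨|c|, fun _ => le_rfl⟩

theorem Mean.map_const {X : Type*} (M : Mean X) (c : ℝ) : M.app (fun _ => c) = c := by
  have h := M.map_smul c (fun _ => 1) (bddFn_const 1)
  rw [M.map_one, mul_one] at h
  have e : (c • fun _ : X => (1 : ℝ)) = fun _ => c := by
    funext x
    simp
  rwa [e] at h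

theorem Mean.le_of_le {X : Type*} (M : Mean X) {f : X → ℝ} {C : ℝ} (hb : BddFn f)
    (hf : ∀ x, f x ≤ C) : M.app f ≤ C := by
  have hb' := hb.smul' (-1)
  have h := M.nonneg ((fun _ => C) + (-1 : ℝ) • f) ((bddFn_const C).add' hb')
    (fun x => by simpa using hf x)
  rw [M.map_add _ _ (bddFn_const C) hb', M.map_smul _ _ hb, M.map_const] at h
  linarith

theorem Mean.abs_le {X : Type*} (M : Mean X) {f : X → ℝ} {C : ℝ}
    (hf : ∀ x, |f x| ≤ C) : |M.app f| ≤ C := by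
  have hb : BddFn f := ⟨C, hf⟩
  have h1 := M.le_of_le hb (fun x => (_root_.abs_le.1 (hf x)).2)
  have h2 := M.le_of_le (C := C) (hb.smul' (-1)) (fun x => by
    have := (_root_.abs_le.1 (hf x)).1
    simp only [Pi.smul_apply, smul_eq_mul]; linarith)
  rw [M.map_smul _ _ hb] at h2
  exact _root_.abs_le.2 ⟨by linarith, h1⟩

theorem Mean.map_sum {X ι : Type*} (M : Mean X) (s : Finset ι) (c : ι → ℝ) (F : ι → X → ℝ)
    (hF : ∀ i, BddFn (F i)) :
    BddFn (∑ i ∈ s, c i • F i) ∧ M.app (∑ i ∈ s, c i • F i) = ∑ i ∈ s, c i * M.app (F i) := by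
  classical
  induction s using Finset.induction_on with
  | empty =>
    simp only [Finset.sum_empty]
    exact ⟨bddFn_const 0, M.map_const 0⟩
  | insert a s ha ih =>
    rw [Finset.sum_insert ha, Finset.sum_insert ha]
    refine ⟨((hF a).smul' _).add' ih.1, ?_⟩
    rw [M.map_add _ _ ((hF a).smul' _) ih.1, M.map_smul _ _ (hF a), ih.2]

/-- Let `G` be an amenable group, `W` a real normed vector space with a `G`-action by
linear isometries, and `V = W*` its topological dual with the dual action
`(g · ψ)(w) = ψ(g⁻¹ · w)`.  Then for every `n ≥ 1` (written `n = m + 1`), every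
`G`-invariant bounded `f : G^{n+1} → V` with `δⁿ f = 0` equals `δ^{n-1} h` for some
`G`-invariant bounded `h : Gⁿ → V`. -/
theorem amenable_dual_boundedlyAcyclic
    {G : Type*} [Group G] (hG : Amenable G)
    {W : Type*} [NormedAddCommGroup W] [NormedSpace ℝ W]
    [DistribMulAction G W] [SMulCommClass G ℝ W]
    (hiso : ∀ (g : G) (w : W), ‖g • w‖ = ‖w‖)
    (m : ℕ) (f : (Fin (m + 2) → G) → (W →L[ℝ] ℝ))
    (hbdd : ∃ C : ℝ, ∀ x, ‖f x‖ ≤ C)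
    (hinv : ∀ (g : G) (x : Fin (m + 2) → G) (w : W),
      f (fun i => g * x i) w = f x (g⁻¹ • w))
    (hcocycle : (fun x : Fin (m + 3) → G =>
      ∑ i : Fin (m + 3), ((-1 : ℝ) ^ (i : ℕ)) • f (x ∘ i.succAbove)) = 0) :
    ∃ h : (Fin (m + 1) → G) → (W →L[ℝ] ℝ),
      (∃ C : ℝ, ∀ x, ‖h x‖ ≤ C) ∧
      (∀ (g : G) (x : Fin (m + 1) → G) (w : W),
        h (fun i => g * x i) w = h x (g⁻¹ • w)) ∧
      (fun x : Fin (m + 2) → G =>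
        ∑ i : Fin (m + 2), ((-1 : ℝ) ^ (i : ℕ)) • h (x ∘ i.succAbove)) = f := by
  obtain ⟨M, hM⟩ := hG
  obtain ⟨C, hC⟩ := hbdd
  have hb0 : ∀ (x : Fin (m + 1) → G) (w : W) (g : G),
      |f (Fin.cons g x : Fin (m + 2) → G) w| ≤ C * ‖w‖ := fun x w g =>
    ((f _).le_opNorm w).trans (mul_le_mul_of_nonneg_right (hC _) (norm_nonneg w))
  have hb : ∀ (x : Fin (m + 1) → G) (w : W),
      BddFn (fun g : G => f (Fin.cons g x : Fin (m + 2) → G) w) := fun x w => ⟨_, hb0 x w⟩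
  let h : (Fin (m + 1) → G) → (W →L[ℝ] ℝ) := fun x =>
    LinearMap.mkContinuous
      { toFun := fun w => M.app (fun g : G => f (Fin.cons g x : Fin (m + 2) → G) w)
        map_add' := fun v w => by
          rw [← M.map_add _ _ (hb x v) (hb x w)]
          congr 1
          funext g
          simp
        map_smul' := fun c w => by
          rw [RingHom.id_apply, smul_eq_mul, ← M.map_smul _ _ (hb x w)]
          congr 1
          funext g
          simp } C (fun w => M.abs_le (hb0 x w))
  have hh : ∀ x w, h x w = M.app (fun g : G => f (Fin.cons g x : Fin (m + 2) → G) w) :=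
    fun _ _ => rfl
  refine ⟨h, ⟨C, fun x => ?_⟩, fun k x w => ?_, ?_⟩
  · exact LinearMap.mkContinuous_norm_le _ ((norm_nonneg _).trans (hC fun _ => 1)) _
  · rw [hh, hh, ← hM k _ (hb x (k⁻¹ • w))]
    congr 1
    funext g
    rw [← hinv]
    congr 2
    funext i
    refine Fin.cases ?_ (fun j => ?_) i <;> simp
  · funext x
    ext w
    have key : M.app (∑ i : Fin (m + 2), ((-1 : ℝ) ^ (i : ℕ)) •
        (fun g : G => f (Fin.cons g (x ∘ i.succAbove) : Fin (m + 2) → G) w)) = f x w := by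
      rw [← M.map_const (f x w)]
      congr 1
      funext g
      have h1 := congrArg (fun φ : W →L[ℝ] ℝ => φ w)
        (congrFun hcocycle (Fin.cons g x : Fin (m + 3) → G))
      have h2 : ∀ i : Fin (m + 2), (Fin.cons g x : Fin (m + 3) → G) ∘ i.succ.succAbove
          = (Fin.cons g (x ∘ i.succAbove) : Fin (m + 2) → G) := by
        intro i
        funext j
        refine Fin.cases ?_ (fun j => ?_) j <;> simp
      have h3 : (Fin.cons g x : Fin (m + 3) → G) ∘ (0 : Fin (m + 3)).succAbove = x := by
        funext j
        simp
      beta_reduce at h1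
      rw [Fin.sum_univ_succ] at h1
      simp only [h2, h3, Fin.val_succ, pow_succ, Fin.val_zero, pow_zero, one_smul, mul_neg,
        mul_one, neg_mul, Finset.sum_neg_distrib, Pi.zero_apply, add_apply, zero_apply,
        sum_apply, smul_apply, smul_eq_mul] at h1
      simp only [Finset.sum_apply, Pi.smul_apply, smul_eq_mul]
      linarith
    rw [(M.map_sum Finset.univ _ _ (fun i : Fin (m + 2) => hb (x ∘ i.succAbove) w)).2] at key
    rw [← key]
    simp [hh]
end

section
/- Let X be a nonempty set and ⋔ a generic relation on X. Then the augmented bounded cochain complex 0 → ℝ → ℓ∞(X₀^⋔) → ℓ∞(X₁^⋔) → ℓ∞(X₂^⋔) → ⋯ is exact: (i) a bounded function f : X₀^⋔ → ℝ satisfies δ⁰ f = 0 if and only if f is constant; and (ii) for every n ≥ 1, every bounded f : Xₙ^⋔ → ℝ with δⁿ f = 0 equals δ^{n−1} g for some bounded g : X_{n−1}^⋔ → ℝ. -/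
/-- A binary relation `R` on `X` is generic if for every finite subset `Y ⊆ X` there is
an `x ∈ X` with `R y x` for all `y ∈ Y`. -/
def GenericRel {X : Type*} (R : X → X → Prop) : Prop :=
  ∀ Y : Finset X, ∃ x : X, ∀ y ∈ Y, R y x

/-- `Xₙ^⋔`: the `(n+1)`-tuples `(x₀, …, xₙ)` with `x_j ⋔ x_i` for all `j < i`. -/
def GenTuple {X : Type*} (R : X → X → Prop) (n : ℕ) : Type _ :=
  {x : Fin (n + 1) → X // ∀ i j : Fin (n + 1), j < i → R (x j) (x i)}

/-- The `i`-th face of a generic tuple, omitting the `i`-th entry. -/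
def face {X : Type*} (R : X → X → Prop) {n : ℕ} (i : Fin (n + 2))
    (x : GenTuple R (n + 1)) : GenTuple R n :=
  ⟨x.1 ∘ i.succAbove, fun a b h =>
    x.2 (i.succAbove a) (i.succAbove b) (Fin.strictMono_succAbove i h)⟩

/-- The simplicial coboundary on functions on generic tuples. -/
def gcoboundary {X : Type*} (R : X → X → Prop) (n : ℕ) (f : GenTuple R n → ℝ) :
    GenTuple R (n + 1) → ℝ :=
  fun x => ∑ i : Fin (n + 2), (-1 : ℝ) ^ (i : ℕ) * f (face R i x)

/-- Append a generic point to a generic tuple. -/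
def snocT {X : Type*} {R : X → X → Prop} {n : ℕ} (x : GenTuple R n) (z : X)
    (h : ∀ k, R (x.1 k) z) : GenTuple R (n + 1) :=
  ⟨Fin.snoc (α := fun _ => X) x.1 z, by
    intro i j hij
    induction i using Fin.lastCases with
    | last =>
      induction j using Fin.lastCases with
      | last => exact absurd hij (lt_irrefl _)
      | cast j => simpa using h j
    | cast i =>
      induction j using Fin.lastCases with
      | last => exact absurd hij (not_lt.mpr (Fin.le_last _))
      | cast j => simpa using x.2 i j (by simpa using hij)⟩

theorem face_last_snocT {X : Type*} {R : X → X → Prop} {n : ℕ} (x : GenTuple R n) (z : X)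
    (h : ∀ k, R (x.1 k) z) : face R (Fin.last (n + 1)) (snocT x z h) = x := by
  apply Subtype.ext
  funext k
  simp [face, snocT]

theorem face_castSucc_snocT {X : Type*} {R : X → X → Prop} {n : ℕ} (x : GenTuple R (n + 1))
    (z : X) (h : ∀ k, R (x.1 k) z) (i : Fin (n + 2)) :
    face R i.castSucc (snocT x z h) =
      snocT (face R i x) z (fun k => h (i.succAbove k)) := by
  apply Subtype.ext
  funext k
  induction k using Fin.lastCases with
  | last =>
    have : i.castSucc.succAbove (Fin.last (n + 1)) = Fin.last (n + 2) := by
      rw [Fin.succAbove_of_le_castSucc _ _ (by simpa using Fin.le_last i)]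
      rfl
    simp [face, snocT, this]
  | cast k => simp [face, snocT, Fin.castSucc_succAbove_castSucc]

theorem exists_generic_ultrafilter {X : Type*} [Nonempty X] (R : X → X → Prop)
    (hR : GenericRel R) : ∃ U : Ultrafilter X, ∀ y, ∀ᶠ z in (U : Filter X), R y z := by
  classical
  have hne : (Filter.generate (Set.range fun y : X => {z | R y z})).NeBot := by
    rw [Filter.generate_neBot_iff]
    intro t ht hfin
    choose! w hw using ht
    obtain ⟨z, hz⟩ := hR (hfin.toFinset.image w)
    refine ⟨z, fun s hs => ?_⟩
    rw [← hw hs]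
    exact hz _ (Finset.mem_image_of_mem _ (hfin.mem_toFinset.mpr hs))
  refine ⟨Ultrafilter.of (Filter.generate (Set.range fun y : X => {z | R y z})),
    fun y => Ultrafilter.of_le _ ?_⟩
  exact Filter.mem_generate_of_mem ⟨y, rfl⟩

theorem bdd_ultrafilter_lim {X : Type*} (U : Ultrafilter X) (φ : X → ℝ) (C : ℝ)
    (h : ∀ x, |φ x| ≤ C) : ∃ a, |a| ≤ C ∧ Filter.Tendsto φ (U : Filter X) (nhds a) := by
  obtain ⟨a, ha, hle⟩ := (isCompact_Icc (a := -C) (b := C)).ultrafilter_le_nhds (U.map φ) (by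
    rw [Filter.le_principal_iff]
    exact Filter.mem_map.mpr (Filter.univ_mem' fun x => abs_le.mp (h x)))
  exact ⟨a, abs_le.mpr ha, hle⟩


/-- For a generic relation `⋔` on a nonempty set `X`, the augmented bounded cochain
complex `0 → ℝ → ℓ∞(X₀^⋔) → ℓ∞(X₁^⋔) → ⋯` is exact:
(i) a bounded `f : X₀^⋔ → ℝ` satisfies `δ⁰ f = 0` iff `f` is constant;
(ii) for every `n ≥ 1` (written `n = m + 1`), every bounded `f : Xₙ^⋔ → ℝ` with
`δⁿ f = 0` equals `δ^{n-1} g` for some bounded `g : X_{n-1}^⋔ → ℝ`. -/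
theorem generic_resolution_exact {X : Type*} [Nonempty X] (R : X → X → Prop)
    (hR : GenericRel R) :
    (∀ f : GenTuple R 0 → ℝ, BddFn f →
      (gcoboundary R 0 f = 0 ↔ ∃ c : ℝ, ∀ x, f x = c)) ∧
    (∀ (m : ℕ) (f : GenTuple R (m + 1) → ℝ), BddFn f →
      gcoboundary R (m + 1) f = 0 →
      ∃ g : GenTuple R m → ℝ, BddFn g ∧ gcoboundary R m g = f) := by
  classical
  refine ⟨fun f _ => ⟨fun hf => ?_, ?_⟩, fun m f hb hf => ?_⟩
  · let pt : X → GenTuple R 0 := fun a => ⟨fun _ => a, fun i j h => by omega⟩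
    have hpt : ∀ x : GenTuple R 0, x = pt (x.1 0) := by
      intro x
      apply Subtype.ext
      funext k
      rw [Fin.fin_one_eq_zero k]
    have key : ∀ (x : GenTuple R 0) (z : X), R (x.1 0) z → f x = f (pt z) := by
      intro x z h
      have h' : ∀ k, R (x.1 k) z := fun k => by rw [Fin.fin_one_eq_zero k]; exact h
      have h1 := congrFun hf (snocT x z h')
      have h2 : face R 1 (snocT x z h') = x := face_last_snocT x z h'
      have h3 : face R 0 (snocT x z h') = pt z := by
        rw [hpt (face R 0 (snocT x z h'))]
        congr 1
      have h4 : (-1 : ℝ) ^ 0 * f (face R 0 (snocT x z h'))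
          + (-1 : ℝ) ^ 1 * f (face R 1 (snocT x z h')) = 0 :=
        (Fin.sum_univ_two (fun i : Fin 2 =>
          (-1 : ℝ) ^ (i : ℕ) * f (face R i (snocT x z h')))).symm.trans h1
      rw [h2, h3] at h4
      linarith
    obtain ⟨a⟩ := ‹Nonempty X›
    refine ⟨f (pt a), fun x => ?_⟩
    obtain ⟨z, hz⟩ := hR {a, x.1 0}
    rw [key x z (hz _ (by simp)), key (pt a) z (hz _ (by simp [pt]))]
  · rintro ⟨c, hc⟩
    funext x
    simp [gcoboundary, Fin.sum_univ_two, hc]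
  · obtain ⟨C, hC⟩ := hb
    obtain ⟨U, hU⟩ := exists_generic_ultrafilter R hR
    let φ : GenTuple R m → X → ℝ := fun x z =>
      if h : ∀ k, R (x.1 k) z then f (snocT x z h) else 0
    have hφ : ∀ x z, |φ x z| ≤ |C| := by
      intro x z
      by_cases h : ∀ k, R (x.1 k) z
      · simp only [φ, dif_pos h]
        exact (hC _).trans (le_abs_self C)
      · simp only [φ, dif_neg h]
        simp
    choose g hg hlim using fun x => bdd_ultrafilter_lim U (φ x) |C| (hφ x)
    refine ⟨fun x => (-1) ^ (m + 1) * g x, ⟨|C|, fun x => ?_⟩, ?_⟩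
    · simpa [abs_mul] using hg x
    funext x
    have hT : Filter.Tendsto
        (fun z => ∑ i : Fin (m + 2), (-1 : ℝ) ^ (i : ℕ) * φ (face R i x) z) U
        (nhds (∑ i : Fin (m + 2), (-1 : ℝ) ^ (i : ℕ) * g (face R i x))) :=
      tendsto_finsetSum _ fun i _ => (hlim (face R i x)).const_mul _
    have hE : ∀ᶠ z in (U : Filter X),
        ∑ i : Fin (m + 2), (-1 : ℝ) ^ (i : ℕ) * φ (face R i x) z = (-1) ^ (m + 1) * f x := by
      have hall : ∀ᶠ z in (U : Filter X), ∀ k, R (x.1 k) z :=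
        Filter.eventually_all.mpr fun k => hU _
      filter_upwards [hall] with z hz
      have h1 := congrFun hf (snocT x z hz)
      simp only [gcoboundary] at h1
      rw [Fin.sum_univ_castSucc, face_last_snocT] at h1
      have h2 : ∀ i : Fin (m + 2), φ (face R i x) z
          = f (face R i.castSucc (snocT x z hz)) := by
        intro i
        rw [face_castSucc_snocT]
        exact dif_pos (fun k => hz (i.succAbove k))
      simp only [h2]
      simp only [Fin.val_castSucc, Fin.val_last, Pi.zero_apply] at h1
      rw [pow_succ] at h1
      linarith
    have hL := tendsto_nhds_unique (hT.congr' hE) tendsto_const_nhds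
    have hs : (-1 : ℝ) ^ (m + 1) * (-1) ^ (m + 1) = 1 := by
      rw [← mul_pow]; simp
    calc gcoboundary R m (fun x => (-1) ^ (m + 1) * g x) x
        = (-1) ^ (m + 1) * ∑ i : Fin (m + 2), (-1 : ℝ) ^ (i : ℕ) * g (face R i x) := by
          rw [Finset.mul_sum]
          exact Finset.sum_congr rfl fun i _ => by ring
      _ = f x := by rw [hL, ← mul_assoc, hs, one_mul]
end

section
/- Any two Cantor sets are homeomorphic: if X and Y are nonempty compact metrizable topological spaces that are totally disconnected and perfect, then there exists a homeomorphism X ≃ Y. -/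
open Filter Topology

/-- Each nonempty clopen set splits into two nonempty clopen pieces, each decided by `U`. -/
theorem cantor_split {X : Type*} [TopologicalSpace X] [CompactSpace X] [T2Space X]
    [TotallyDisconnectedSpace X] (hX : ∀ x : X, (𝓝[≠] x).NeBot)
    (U : Set X) (hU : IsClopen U) (A : Set X) (hA : IsClopen A) (hne : A.Nonempty) :
    ∃ B : Set X, IsClopen B ∧ (A ∩ B).Nonempty ∧ (A \ B).Nonempty ∧
      (∀ x ∈ A ∩ B, ∀ y ∈ A ∩ B, x ∈ U → y ∈ U) ∧
      (∀ x ∈ A \ B, ∀ y ∈ A \ B, x ∈ U → y ∈ U) := by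
  by_cases h : (A ∩ U).Nonempty ∧ (A \ U).Nonempty
  · exact ⟨U, hU, h.1, h.2, fun x _ y hy _ => hy.2, fun x hx y _ hxU => absurd hxU hx.2⟩
  · have key : ∀ x ∈ A, ∀ y ∈ A, x ∈ U → y ∈ U := by
      intro x hx y hy hxU
      by_contra hyU
      exact h ⟨⟨x, hx, hxU⟩, ⟨y, hy, hyU⟩⟩
    obtain ⟨x, hx⟩ := hne
    have hm : A ∩ {x}ᶜ ∈ 𝓝[≠] x :=
      inter_mem (mem_nhdsWithin_of_mem_nhds (hA.isOpen.mem_nhds hx)) self_mem_nhdsWithin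
    obtain ⟨y, hyA, hyx⟩ := (hX x).nonempty_of_mem hm
    obtain ⟨B, hB, hxB, hBy⟩ := (isTopologicalBasis_isClopen (X := X)).exists_subset_of_mem_open
      (show x ∈ ({y}ᶜ : Set X) from fun hh => hyx hh.symm) isOpen_compl_singleton
    exact ⟨B, hB, ⟨x, hx, hxB⟩, ⟨y, hyA, fun hh => hBy hh rfl⟩,
      fun a ha b hb => key a ha.1 b hb.1, fun a ha b hb => key a ha.1 b hb.1⟩

/-- The branch of the scheme given by the splitting function `S` along `f`. -/
def cantorBranch {X : Type*} (S : ℕ → Set X → Set X) (f : ℕ → Bool) : ℕ → Set X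
  | 0 => Set.univ
  | n + 1 => if f n = true then cantorBranch S f n ∩ S n (cantorBranch S f n)
      else cantorBranch S f n \ S n (cantorBranch S f n)

theorem cantorBranch_congr {X : Type*} (S : ℕ → Set X → Set X) (f g : ℕ → Bool) (n : ℕ)
    (h : ∀ i < n, f i = g i) : cantorBranch S f n = cantorBranch S g n := by
  induction n with
  | zero => rfl
  | succ n ih =>
    have := ih fun i hi => h i (by omega)
    simp only [cantorBranch, this, h n (by omega)]

open Classical in
/-- The branch of sets containing a point. -/
noncomputable def cantorPoint {X : Type*} (S : ℕ → Set X → Set X) (x : X) : ℕ → Set X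
  | 0 => Set.univ
  | n + 1 => if x ∈ S n (cantorPoint S x n) then cantorPoint S x n ∩ S n (cantorPoint S x n)
      else cantorPoint S x n \ S n (cantorPoint S x n)

theorem exists_branch_mem {X : Type*} (S : ℕ → Set X → Set X) (x : X) :
    ∃ f : ℕ → Bool, ∀ n, x ∈ cantorBranch S f n := by
  classical
  let f : ℕ → Bool := fun n => decide (x ∈ S n (cantorPoint S x n))
  refine ⟨f, fun n => ?_⟩
  suffices h : cantorBranch S f n = cantorPoint S x n ∧ x ∈ cantorBranch S f n from h.2
  induction n with
  | zero => exact ⟨rfl, trivial⟩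
  | succ n ih =>
    obtain ⟨h1, h2⟩ := ih
    rw [h1] at h2
    by_cases hx : x ∈ S n (cantorPoint S x n)
    · simp [cantorBranch, cantorPoint, f, h1, hx, h2]
    · simp [cantorBranch, cantorPoint, f, h1, hx, h2]

/-- A Cantor set is homeomorphic to the Cantor space. -/
theorem cantor_homeo_bool {X : Type*} [TopologicalSpace X] [CompactSpace X]
    [TopologicalSpace.MetrizableSpace X] [TotallyDisconnectedSpace X] [Nonempty X]
    (hX : ∀ x : X, (𝓝[≠] x).NeBot) : Nonempty ((ℕ → Bool) ≃ₜ X) := by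
  classical
  letI := TopologicalSpace.metrizableSpaceMetric X
  have hsc : SecondCountableTopology X := inferInstance
  obtain ⟨b, hbsub, hbc, hb⟩ := (isTopologicalBasis_isClopen (X := X)).exists_countable
  have hbne : b.Nonempty := by
    obtain ⟨x⟩ := ‹Nonempty X›
    obtain ⟨B, hB, _⟩ := hb.exists_subset_of_mem_open (Set.mem_univ x) isOpen_univ
    exact ⟨B, hB⟩
  obtain ⟨U, rfl⟩ := hbc.exists_eq_range hbne
  have hU : ∀ n, IsClopen (U n) := fun n => hbsub ⟨n, rfl⟩
  have hsplit := fun (n : ℕ) (A : Set X) => cantor_split hX (U n) (hU n) A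
  choose! S hS using hsplit
  have hD : ∀ f n, IsClopen (cantorBranch S f n) ∧ (cantorBranch S f n).Nonempty := by
    intro f n
    induction n with
    | zero => exact ⟨isClopen_univ, Set.univ_nonempty⟩
    | succ n ih =>
      obtain ⟨h1, h2, h3, -, -⟩ := hS n _ ih.1 ih.2
      by_cases hf : f n = true
      · simp only [cantorBranch, hf, if_true]; exact ⟨ih.1.inter h1, h2⟩
      · simp only [cantorBranch, hf]; exact ⟨ih.1.diff h1, h3⟩
  have hdec : ∀ f n, ∀ x ∈ cantorBranch S f (n + 1), ∀ y ∈ cantorBranch S f (n + 1),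
      x ∈ U n → y ∈ U n := by
    intro f n
    obtain ⟨-, -, -, h4, h5⟩ := hS n _ (hD f n).1 (hD f n).2
    by_cases hf : f n = true
    · simp only [cantorBranch, hf, if_true]; exact h4
    · simp only [cantorBranch, hf]; exact h5
  have hanti : ∀ f n, cantorBranch S f (n + 1) ⊆ cantorBranch S f n := by
    intro f n x hx
    simp only [cantorBranch] at hx
    split_ifs at hx
    · exact hx.1
    · exact hx.1
  have hex : ∀ f, ∃ x, ∀ n, x ∈ cantorBranch S f n := by
    intro f
    obtain ⟨x, hx⟩ := IsCompact.nonempty_iInter_of_sequence_nonempty_isCompact_isClosed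
      (cantorBranch S f) (hanti f) (fun n => (hD f n).2) (hD f 0).1.isClosed.isCompact
      (fun n => (hD f n).1.isClosed)
    exact ⟨x, fun n => Set.mem_iInter.1 hx n⟩
  choose g hg using hex
  have huniq : ∀ f x, (∀ n, x ∈ cantorBranch S f n) → g f = x := by
    intro f x hx
    by_contra hne
    obtain ⟨_, ⟨n, rfl⟩, h1, h2⟩ := hb.exists_subset_of_mem_open
      (show g f ∈ ({x}ᶜ : Set X) from hne) isOpen_compl_singleton
    exact h2 (hdec f n _ (hg f _) _ (hx _) h1) rfl
  have hsurj : Function.Surjective g := by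
    intro x
    obtain ⟨f, hf⟩ := exists_branch_mem S x
    exact ⟨f, huniq f x hf⟩
  have hinj : Function.Injective g := by
    intro f f' hff
    have key : ∀ n, ∀ i < n, f i = f' i := by
      intro n
      induction n with
      | zero => intro i hi; omega
      | succ n ih =>
        intro i hi
        rcases Nat.lt_succ_iff_lt_or_eq.1 hi with h | rfl
        · exact ih i h
        have hc := cantorBranch_congr S f f' i ih
        have h1 := hg f (i + 1)
        have h2 := hg f' (i + 1)
        rw [← hff] at h2
        simp only [cantorBranch, ← hc] at h1 h2
        cases hfi : f i <;> cases hfi' : f' i <;> simp_all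
    exact funext fun i => key (i + 1) i (by omega)
  have hcont : Continuous g := by
    rw [hb.continuous_iff]
    rintro _ ⟨n, rfl⟩
    rw [isOpen_iff_forall_mem_open]
    intro f hf
    refine ⟨Set.pi (Set.Iio (n + 1)) (fun i => {f i}), ?_,
      isOpen_set_pi (Set.finite_Iio _) (fun _ _ => isOpen_discrete _), fun i _ => rfl⟩
    intro f' hf'
    have hc := cantorBranch_congr S f' f (n + 1) (fun i hi => hf' i hi)
    exact hdec f n _ (hg f _) _ (hc ▸ hg f' _) hf
  exact ⟨Continuous.homeoOfEquivCompactToT2 (f := Equiv.ofBijective g ⟨hinj, hsurj⟩) hcont⟩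

/-- Any two Cantor sets (nonempty compact metrizable totally disconnected perfect
topological spaces) are homeomorphic. -/
theorem cantor_sets_homeomorphic {X Y : Type*}
    [TopologicalSpace X] [TopologicalSpace Y]
    [CompactSpace X] [CompactSpace Y]
    [TopologicalSpace.MetrizableSpace X] [TopologicalSpace.MetrizableSpace Y]
    [TotallyDisconnectedSpace X] [TotallyDisconnectedSpace Y]
    [Nonempty X] [Nonempty Y]
    (hX : ∀ x : X, (𝓝[≠] x).NeBot) (hY : ∀ y : Y, (𝓝[≠] y).NeBot) :
    Nonempty (X ≃ₜ Y) := by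
  obtain ⟨e⟩ := cantor_homeo_bool hX
  obtain ⟨e'⟩ := cantor_homeo_bool hY
  exact ⟨e.symm.trans e'⟩
end

section
/- Let K be a Cantor space. Given embeddings h₀,…,h_k : K → K whose images are pairwise disjoint and do not cover K, and embeddings h̄₀,…,h̄_k : K → K whose images are pairwise disjoint and do not cover K, there exists a homeomorphism g of K with g ∘ h_i = h̄_i for all 0 ≤ i ≤ k. -/
/-- An embedding of Cantor space into itself: a homeomorphism onto its image whose image
is open (hence clopen). -/
def IsCantorEmbedding (f : CantorSpace → CantorSpace) : Prop :=
  Topology.IsEmbedding f ∧ IsOpen (Set.range f)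

open Set Topology

/-- Splitting off the first `n` coordinates. -/
def cantorSplit (n : ℕ) : (ℕ → Bool) ≃ₜ (Fin n → Bool) × (ℕ → Bool) where
  toFun x := (fun i => x i, fun m => x (m + n))
  invFun p := fun m => if h : m < n then p.1 ⟨m, h⟩ else p.2 (m - n)
  left_inv x := by
    funext m
    by_cases h : m < n
    · simp [h]
    · simp [h, Nat.sub_add_cancel (not_lt.mp h)]
  right_inv p := by
    ext m <;> simp
  continuous_toFun := by fun_prop
  continuous_invFun := by
    refine continuous_pi fun m => ?_
    by_cases h : m < n
    · simp only [h, dite_true]; fun_prop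
    · simp only [h, dite_false]; fun_prop

lemma cantor_sum : Nonempty ((ℕ → Bool) ⊕ (ℕ → Bool) ≃ₜ (ℕ → Bool)) := by
  let f : (ℕ → Bool) ⊕ (ℕ → Bool) → (ℕ → Bool) :=
    Sum.elim (fun x n => Nat.casesOn n false x) (fun x n => Nat.casesOn n true x)
  have hf : Continuous f := by
    refine Continuous.sumElim ?_ ?_ <;>
    · refine continuous_pi fun n => ?_
      cases n
      · exact continuous_const
      · exact continuous_apply _
  have hb : Function.Bijective f := by
    constructor
    · rintro (x | x) (y | y) h
      · congr 1; funext n; exact congrFun h (n + 1)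
      · exact absurd (congrFun h 0) (by simp [f])
      · exact absurd (congrFun h 0) (by simp [f])
      · congr 1; funext n; exact congrFun h (n + 1)
    · intro y
      cases h : y 0
      · refine ⟨Sum.inl fun n => y (n + 1), ?_⟩
        funext n; cases n
        · exact h.symm
        · rfl
      · refine ⟨Sum.inr fun n => y (n + 1), ?_⟩
        funext n; cases n
        · exact h.symm
        · rfl
  exact ⟨Continuous.homeoOfEquivCompactToT2 (f := Equiv.ofBijective f hb) hf⟩

lemma cantor_fin (n : ℕ) : Nonempty (Fin (n + 1) × (ℕ → Bool) ≃ₜ (ℕ → Bool)) := by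
  induction n with
  | zero => exact ⟨Homeomorph.uniqueProd (Fin 1) (ℕ → Bool)⟩
  | succ n ih =>
    obtain ⟨e⟩ := ih
    obtain ⟨s⟩ := cantor_sum
    let d : Fin (n + 1 + 1) ≃ₜ Fin (n + 1) ⊕ Fin 1 :=
      (finSumFinEquiv (m := n + 1) (n := 1)).symm.toHomeomorphOfDiscrete
    exact ⟨(d.prodCongr (Homeomorph.refl _)).trans <| Homeomorph.sumProdDistrib.trans <|
      (e.sumCongr (Homeomorph.uniqueProd (Fin 1) (ℕ → Bool))).trans s⟩

lemma cantor_finite (S : Type) [Finite S] [Nonempty S] [TopologicalSpace S] [DiscreteTopology S] :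
    Nonempty (S × (ℕ → Bool) ≃ₜ (ℕ → Bool)) := by
  obtain ⟨n, ⟨e⟩⟩ := Finite.exists_equiv_fin S
  cases n with
  | zero => exact (IsEmpty.false (e (Classical.arbitrary S))).elim
  | succ n =>
    obtain ⟨c⟩ := cantor_fin n
    exact ⟨(e.toHomeomorphOfDiscrete.prodCongr (Homeomorph.refl _)).trans c⟩

lemma clopen_dep (U : Set (ℕ → Bool)) (hU : IsClopen U) :
    ∃ n : ℕ, ∀ x y : ℕ → Bool, (∀ m < n, x m = y m) → (x ∈ U ↔ y ∈ U) := by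
  let A : ℕ → Set (ℕ → Bool) := fun n =>
    {x | ∀ y : ℕ → Bool, (∀ m < n, x m = y m) → (x ∈ U ↔ y ∈ U)}
  have hcyl : ∀ (x : ℕ → Bool) (n : ℕ), IsOpen {y : ℕ → Bool | ∀ m < n, x m = y m} := by
    intro x n
    have : {y : ℕ → Bool | ∀ m < n, x m = y m} = ⋂ m ∈ Set.Iio n, {y | x m = y m} := by
      ext; simp
    rw [this]
    refine (Set.finite_Iio n).isOpen_biInter fun m _ => ?_
    exact (isOpen_discrete {b | x m = b}).preimage (continuous_apply m)
  have hopen : ∀ n, IsOpen (A n) := by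
    intro n
    rw [isOpen_iff_forall_mem_open]
    intro x hx
    refine ⟨_, ?_, hcyl x n, fun m _ => rfl⟩
    intro y hy z hz
    rw [← hx y hy, ← hx z fun m hm => (hy m hm).trans (hz m hm)]
  have hV : ∀ V : Set (ℕ → Bool), IsOpen V → ∀ x ∈ V, ∃ n : ℕ, ∀ y : ℕ → Bool,
      (∀ m < n, x m = y m) → y ∈ V := by
    intro V hV x hx
    obtain ⟨I, u, hu, hs⟩ := isOpen_pi_iff.mp hV x hx
    refine ⟨I.sup id + 1, fun y hy => hs fun i hi => ?_⟩
    rw [← hy i (Nat.lt_succ_of_le (Finset.le_sup (f := id) hi))]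
    exact (hu i hi).2
  have hcov : (Set.univ : Set (ℕ → Bool)) ⊆ ⋃ n, A n := by
    intro x _
    rw [Set.mem_iUnion]
    by_cases hx : x ∈ U
    · obtain ⟨n, hn⟩ := hV U hU.isOpen x hx
      exact ⟨n, fun y hy => iff_of_true hx (hn y hy)⟩
    · obtain ⟨n, hn⟩ := hV Uᶜ hU.compl.isOpen x hx
      exact ⟨n, fun y hy => iff_of_false hx (hn y hy)⟩
  have hmono : Monotone A := fun a b hab x hx y hy => hx y fun m hm => hy m (hm.trans_le hab)
  obtain ⟨n, hn⟩ := isCompact_univ.elim_directed_cover A hopen hcov hmono.directed_le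
  exact ⟨n, fun x y h => hn (Set.mem_univ x) y h⟩

lemma clopen_homeo (U : Set (ℕ → Bool)) (hU : IsClopen U) (hne : U.Nonempty) :
    Nonempty (U ≃ₜ (ℕ → Bool)) := by
  obtain ⟨n, hn⟩ := clopen_dep U hU
  let S : Set (Fin n → Bool) := {a | ∃ x ∈ U, ∀ i : Fin n, x i = a i}
  have hS : Nonempty S := by
    obtain ⟨x, hx⟩ := hne
    exact ⟨⟨fun i => x i, x, hx, fun _ => rfl⟩⟩
  obtain ⟨c⟩ := cantor_finite S
  have key : ∀ x, x ∈ U ↔ cantorSplit n x ∈ S ×ˢ (Set.univ : Set (ℕ → Bool)) := by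
    intro x
    constructor
    · intro hx
      exact ⟨⟨x, hx, fun _ => rfl⟩, trivial⟩
    · rintro ⟨⟨y, hy, h⟩, -⟩
      exact (hn y x fun m hm => h ⟨m, hm⟩).mp hy
  exact ⟨((cantorSplit n).subtype key).trans <| (Homeomorph.Set.prod S Set.univ).trans <|
    ((Homeomorph.refl S).prodCongr (Homeomorph.Set.univ _)).trans c⟩

lemma cantor_assemble (k : ℕ) (h : Fin (k + 1) → CantorSpace → CantorSpace)
    (hemb : ∀ i, IsCantorEmbedding (h i))
    (hdisj : ∀ i j, i ≠ j → Disjoint (Set.range (h i)) (Set.range (h j)))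
    (hncov : (⋃ i, Set.range (h i)) ≠ Set.univ) :
    ∃ φ : (Fin (k + 1) × (ℕ → Bool)) ⊕ (ℕ → Bool) ≃ₜ (ℕ → Bool),
      ∀ i x, φ (Sum.inl (i, x)) = h i x := by
  have hclo : IsClopen (⋃ i, Set.range (h i)) :=
    isClopen_iUnion_of_finite fun i =>
      ⟨(isCompact_range (hemb i).1.continuous).isClosed, (hemb i).2⟩
  obtain ⟨c⟩ := clopen_homeo _ hclo.compl (Set.nonempty_compl.mpr hncov)
  let f : (Fin (k + 1) × (ℕ → Bool)) ⊕ (ℕ → Bool) → (ℕ → Bool) :=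
    Sum.elim (fun p => h p.1 p.2) (fun x => (c.symm x : ℕ → Bool))
  have hf : Continuous f := by
    refine Continuous.sumElim ?_ (continuous_subtype_val.comp c.symm.continuous)
    exact continuous_prod_of_discrete_left.mpr fun i => (hemb i).1.continuous
  have hb : Function.Bijective f := by
    constructor
    · rintro (⟨i, x⟩ | x) (⟨j, y⟩ | y) hxy
      · change h i x = h j y at hxy
        by_cases hij : i = j
        · subst hij
          rw [(hemb i).1.injective hxy]
        · exact (Set.disjoint_left.mp (hdisj i j hij) ⟨x, rfl⟩ ⟨y, hxy.symm⟩).elim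
      · exact ((c.symm y).2 (Set.mem_iUnion.mpr ⟨i, x, hxy⟩)).elim
      · exact ((c.symm x).2 (Set.mem_iUnion.mpr ⟨j, y, hxy.symm⟩)).elim
      · exact congrArg Sum.inr (c.symm.injective (Subtype.ext hxy))
    · intro y
      by_cases hy : y ∈ ⋃ i, Set.range (h i)
      · obtain ⟨i, x, hx⟩ := Set.mem_iUnion.mp hy
        exact ⟨Sum.inl (i, x), hx⟩
      · exact ⟨Sum.inr (c ⟨y, hy⟩), by simp [f]⟩
  exact ⟨Continuous.homeoOfEquivCompactToT2 (f := Equiv.ofBijective f hb) hf, fun _ _ => rfl⟩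

/-- Given embeddings `h₀, …, h_k` of the Cantor space with pairwise disjoint images not
covering the space, and embeddings `h̄₀, …, h̄_k` likewise, there is a homeomorphism `g`
of the Cantor space with `g ∘ hᵢ = h̄ᵢ` for all `i`. -/
theorem homeo_matching_embeddings (k : ℕ)
    (h hbar : Fin (k + 1) → CantorSpace → CantorSpace)
    (hemb : ∀ i, IsCantorEmbedding (h i))
    (hbaremb : ∀ i, IsCantorEmbedding (hbar i))
    (hdisj : ∀ i j, i ≠ j → Disjoint (Set.range (h i)) (Set.range (h j)))
    (hbardisj : ∀ i j, i ≠ j → Disjoint (Set.range (hbar i)) (Set.range (hbar j)))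
    (hncov : (⋃ i, Set.range (h i)) ≠ Set.univ)
    (hbarncov : (⋃ i, Set.range (hbar i)) ≠ Set.univ) :
    ∃ g : Homeomorph CantorSpace CantorSpace,
      ∀ (i : Fin (k + 1)) (x : CantorSpace), g (h i x) = hbar i x := by
  obtain ⟨φ, hφ⟩ := cantor_assemble k h hemb hdisj hncov
  obtain ⟨ψ, hψ⟩ := cantor_assemble k hbar hbaremb hbardisj hbarncov
  refine ⟨φ.symm.trans ψ, fun i x => ?_⟩
  rw [← hφ, ← hψ]
  simp
end

section
/- Let K be a Cantor set with metric d, and let U ⊊ K be a nonempty proper subset that is both open and closed. Then there exists a shrinking τ : K → K with τ(K) = U, i.e. a map τ that is a homeomorphism onto its image, whose image is open in K, and such that the diameters diam(τⁿ(K)) tend to 0 as n → ∞. -/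
open Filter Topology

/-- Brouwer-type coding of a Cantor set by binary sequences, with prescribed first clopen set. -/
theorem cantor_coding {K : Type*} [MetricSpace K] [CompactSpace K]
    [TotallyDisconnectedSpace K] [Nonempty K]
    (hperf : ∀ x : K, (𝓝[≠] x).NeBot)
    (U : Set K) (hne : U.Nonempty) (hproper : U ≠ Set.univ) (hU : IsClopen U) :
    ∃ h : K ≃ₜ (ℕ → Bool), ∀ k, h k 0 = true ↔ k ∈ U := by
  classical
  -- countable separating family starting with U
  obtain ⟨C, hC0, hCc, hCsep⟩ : ∃ C : ℕ → Set K, C 0 = U ∧ (∀ n, IsClopen (C n)) ∧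
      ∀ x y, x ≠ y → ∃ n, x ∈ C n ∧ y ∉ C n := by
    haveI : Countable (TopologicalSpace.Clopens K) :=
      TopologicalSpace.Clopens.countable_iff_secondCountable.2 inferInstance
    obtain ⟨e, he⟩ := exists_surjective_nat (TopologicalSpace.Clopens K)
    refine ⟨fun n => Nat.casesOn n U (fun m => (e m : Set K)), rfl, ?_, ?_⟩
    · rintro (_ | n)
      · exact hU
      · exact (e n).isClopen
    · intro x y hxy
      obtain ⟨V, hV, hx, hy⟩ := exists_isClopen_of_totally_separated hxy
      obtain ⟨m, hm⟩ := he ⟨V, hV⟩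
      refine ⟨m + 1, ?_, ?_⟩
      · simpa [hm] using hx
      · simpa [hm] using hy
  have hsplit : ∀ (n : ℕ) (D : Set K), ∃ L : Set K, IsClopen L ∧
      (IsClopen D → D.Nonempty → (D ∩ L).Nonempty ∧ (D \ L).Nonempty) ∧
      ((D ∩ C n).Nonempty → (D \ C n).Nonempty → L = C n) := by
    intro n D
    by_cases h : (D ∩ C n).Nonempty ∧ (D \ C n).Nonempty
    · exact ⟨C n, hCc n, fun _ _ => h, fun _ _ => rfl⟩
    by_cases hD : IsClopen D ∧ D.Nonempty
    · obtain ⟨hD, x, hx⟩ := hD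
      haveI := hperf x
      obtain ⟨y, hy, hyx⟩ : ∃ y, y ∈ D ∧ y ≠ x := by
        have h1 : D ∩ {x}ᶜ ∈ 𝓝[≠] x :=
          inter_mem (mem_nhdsWithin_of_mem_nhds (hD.isOpen.mem_nhds hx)) self_mem_nhdsWithin
        obtain ⟨y, hy⟩ := Filter.nonempty_of_mem h1
        exact ⟨y, hy.1, hy.2⟩
      obtain ⟨V, hV, hyV, hxV⟩ := exists_isClopen_of_totally_separated hyx
      exact ⟨V, hV, fun _ _ => ⟨⟨y, hy, hyV⟩, ⟨x, hx, hxV⟩⟩, fun a b => absurd ⟨a, b⟩ h⟩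
    · exact ⟨C n, hCc n, fun a b => absurd ⟨a, b⟩ hD, fun _ _ => rfl⟩
  choose L hLc hLs hLC using hsplit
  let D : (ℕ → Bool) → ℕ → Set K := fun x n =>
    Nat.rec Set.univ (fun n D => if x n = true then D ∩ L n D else D \ L n D) n
  have D0 : ∀ x, D x 0 = Set.univ := fun x => rfl
  have DS : ∀ x n, D x (n+1) = if x n = true then D x n ∩ L n (D x n) else D x n \ L n (D x n) :=
    fun x n => rfl
  let E : K → ℕ → Set K := fun k n =>
    Nat.rec Set.univ (fun n D => if k ∈ L n D then D ∩ L n D else D \ L n D) n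
  have E0 : ∀ k, E k 0 = Set.univ := fun x => rfl
  have ES : ∀ k n, E k (n+1) = if k ∈ L n (E k n) then E k n ∩ L n (E k n)
      else E k n \ L n (E k n) :=
    fun x n => rfl
  let f : K → ℕ → Bool := fun k n => decide (k ∈ L n (E k n))
  have hf : ∀ k n, f k n = true ↔ k ∈ L n (E k n) := fun k n => by simp [f]
  clear_value D E f
  have hED : ∀ k n, E k n = D (f k) n := by
    intro k n
    induction n with
    | zero => rw [E0, D0]
    | succ n ih => simp only [ES, DS, hf, ih]
  have hkE : ∀ k n, k ∈ E k n := by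
    intro k n
    induction n with
    | zero => rw [E0]; trivial
    | succ n ih =>
      rw [ES]
      split_ifs with h
      · exact ⟨ih, h⟩
      · exact ⟨ih, h⟩
  have hDc : ∀ x n, IsClopen (D x n) ∧ (D x n).Nonempty := by
    intro x n
    induction n with
    | zero => rw [D0]; exact ⟨isClopen_univ, Set.univ_nonempty⟩
    | succ n ih =>
      rw [DS]
      have := hLs n _ ih.1 ih.2
      split_ifs with h
      · exact ⟨ih.1.inter (hLc _ _), this.1⟩
      · exact ⟨ih.1.diff (hLc _ _), this.2⟩
  have hDE : ∀ x k, (∀ n, k ∈ D x n) → f k = x := by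
    intro x k hk
    have key : ∀ n, k ∈ L n (D x n) ↔ x n = true := by
      intro n
      have := hk (n+1)
      rw [DS] at this
      split_ifs at this with h
      · exact ⟨fun _ => h, fun _ => this.2⟩
      · exact ⟨fun h' => absurd h' this.2, fun h' => absurd h' h⟩
    have hE : ∀ n, E k n = D x n := by
      intro n
      induction n with
      | zero => rw [E0, D0]
      | succ n ih => simp only [ES, DS, ih, key]
    funext n
    rw [Bool.eq_iff_iff, hf, hE, key]
  have hinj : Function.Injective f := by
    intro x y hxy
    by_contra hne
    obtain ⟨n, hx, hy⟩ := hCsep x y hne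
    have hEE : E x n = E y n := by rw [hED, hED, hxy]
    have hL := hLC n (E x n) ⟨x, hkE x n, hx⟩ ⟨y, hEE ▸ hkE y n, hy⟩
    have h1 : f x n = true := (hf x n).2 (hL ▸ hx)
    rw [hxy, hf, ← hEE, hL] at h1
    exact hy h1
  have hsurj : Function.Surjective f := by
    intro x
    have : (⋂ n, D x n).Nonempty := by
      refine IsCompact.nonempty_iInter_of_sequence_nonempty_isCompact_isClosed (D x) ?_
        (fun n => (hDc x n).2) ((hDc x 0).1.isClosed.isCompact) (fun n => (hDc x n).1.isClosed)
      intro n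
      rw [DS]
      split_ifs
      · exact Set.inter_subset_left
      · exact Set.diff_subset
    obtain ⟨k, hk⟩ := this
    exact ⟨k, hDE x k (Set.mem_iInter.1 hk)⟩
  have hLev : ∀ (S : Set K), IsClopen S → ∀ k, ∀ᶠ k' in 𝓝 k, (k' ∈ S ↔ k ∈ S) := by
    intro S hS k
    by_cases h : k ∈ S
    · filter_upwards [hS.isOpen.mem_nhds h] with k' hk' using by simp [h, hk']
    · filter_upwards [hS.compl.isOpen.mem_nhds h] with k' hk'
      exact ⟨fun h' => absurd h' hk', fun h' => absurd h' h⟩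
  have hEloc : ∀ n k, ∀ᶠ k' in 𝓝 k, E k' n = E k n := by
    intro n k
    induction n with
    | zero => simp [E0]
    | succ n ih =>
      filter_upwards [ih, hLev _ (hLc n (E k n)) k] with k' h1 h2
      simp only [ES, h1, h2]
  have hcont : Continuous f := by
    refine continuous_pi fun n => continuous_iff_continuousAt.2 fun k => ?_
    have : ∀ᶠ k' in 𝓝 k, f k' n = f k n := by
      filter_upwards [hEloc n k, hLev _ (hLc n (E k n)) k] with k' h1 h2
      rw [Bool.eq_iff_iff, hf, hf, h1, h2]
    exact tendsto_nhds_of_eventually_eq this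
  refine ⟨hcont.homeoOfEquivCompactToT2 (f := Equiv.ofBijective f ⟨hinj, hsurj⟩), fun k => ?_⟩
  change f k 0 = true ↔ _
  have hV : (Set.univ \ U).Nonempty := by
    obtain ⟨z, hz⟩ := (Set.ne_univ_iff_exists_notMem U).1 hproper
    exact ⟨z, trivial, hz⟩
  rw [hf, E0, hLC 0 Set.univ (by simpa [hC0] using hne) (by rw [hC0]; exact hV), hC0]

/-- For every nonempty proper clopen subset `U` of a (metric) Cantor set `K`, there is a
shrinking `τ : K → K` with `τ(K) = U`: a homeomorphism onto its image with open image
such that `diam (τⁿ(K)) → 0` as `n → ∞`. -/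
theorem shrinking_exists {K : Type*} [MetricSpace K] [CompactSpace K]
    [TotallyDisconnectedSpace K] [Nonempty K]
    (hperf : ∀ x : K, (𝓝[≠] x).NeBot)
    (U : Set K) (hne : U.Nonempty) (hproper : U ≠ Set.univ)
    (hUo : IsOpen U) (hUc : IsClosed U) :
    ∃ τ : K → K, Topology.IsEmbedding τ ∧ IsOpen (Set.range τ) ∧ Set.range τ = U ∧
      Filter.Tendsto (fun n : ℕ => Metric.diam (Set.range (τ^[n])))
        Filter.atTop (nhds 0) := by
  obtain ⟨h, hh⟩ := cantor_coding hperf U hne hproper ⟨hUc, hUo⟩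
  let c : (ℕ → Bool) → (ℕ → Bool) := fun y n => Nat.casesOn n true y
  have c0 : ∀ y, c y 0 = true := fun y => rfl
  have cS : ∀ y n, c y (n+1) = y n := fun y n => rfl
  clear_value c
  have hcc : Continuous c := by
    refine continuous_pi fun n => ?_
    cases n with
    | zero => simp only [c0]; exact continuous_const
    | succ n => simp only [cS]; exact continuous_apply n
  have hci : Function.Injective c := by
    intro x y hxy
    funext n
    rw [← cS x, ← cS y, hxy]
  let τ : K → K := fun k => h.symm (c (h k))
  have hτ : ∀ k, h (τ k) = c (h k) := fun k => by simp [τ]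
  have hτc : Continuous τ := h.symm.continuous.comp (hcc.comp h.continuous)
  have hτi : Function.Injective τ := h.symm.injective.comp (hci.comp h.injective)
  clear_value τ
  have hr : Set.range τ = U := by
    ext z
    constructor
    · rintro ⟨k, rfl⟩
      rw [← hh, hτ, c0]
    · intro hz
      refine ⟨h.symm (fun n => h z (n+1)), h.injective ?_⟩
      rw [hτ, h.apply_symm_apply]
      funext n
      cases n with
      | zero => rw [c0, (hh z).2 hz]
      | succ n => rw [cS]
  refine ⟨τ, (hτc.isClosedEmbedding hτi).isEmbedding, hr ▸ hUo, hr, ?_⟩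
  have hit : ∀ n k i, i < n → h (τ^[n] k) i = true := by
    intro n
    induction n with
    | zero => intro k i hi; omega
    | succ n ih =>
      intro k i hi
      rw [Function.iterate_succ_apply', hτ]
      cases i with
      | zero => exact c0 _
      | succ i => rw [cS]; exact ih k i (by omega)
  let p : K := h.symm (fun _ => true)
  rw [Metric.tendsto_atTop]
  intro ε hε
  have hO : IsOpen (h.symm ⁻¹' Metric.ball p (ε / 3)) :=
    Metric.isOpen_ball.preimage h.symm.continuous
  obtain ⟨I, u, hu, hsub⟩ := isOpen_pi_iff.1 hO (fun _ => true)
    (by simpa [p] using (by positivity : 0 < ε / 3))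
  refine ⟨I.sup id + 1, fun n hn => ?_⟩
  have hball : Set.range (τ^[n]) ⊆ Metric.ball p (ε / 3) := by
    rintro _ ⟨k, rfl⟩
    have : h (τ^[n] k) ∈ h.symm ⁻¹' Metric.ball p (ε / 3) := by
      apply hsub
      intro i hi
      have hi' : i ≤ I.sup id := Finset.le_sup (f := id) hi
      rw [hit n k i (by omega)]
      exact (hu i hi).2
    simpa using this
  have hd : Metric.diam (Set.range (τ^[n])) ≤ 2 * (ε / 3) :=
    (Metric.diam_mono hball Metric.isBounded_ball).trans (Metric.diam_ball (by positivity))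
  rw [Real.dist_eq, sub_zero, abs_of_nonneg Metric.diam_nonneg]
  linarith
end

section
/- If g, h ∈ V are two elements of Thompson's group V that both fix a point z of Cantor space (g(z) = z and h(z) = z), then the commutator [g,h] = g⁻¹h⁻¹gh fixes a whole neighborhood of z pointwise: there is an open set U ∋ z with [g,h](u) = u for all u ∈ U. -/
/-- The cylinder of a finite binary word `r`: the set of points of Cantor space
beginning with `r`. -/
def cylinder (r : List Bool) : Set CantorSpace :=
  {x | ∀ i : Fin r.length, x i = r.get i}

/-- Concatenation of a finite binary word with an infinite tail. -/
def wordConcat (r : List Bool) (t : CantorSpace) : CantorSpace := fun n =>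
  if h : n < r.length then r.get ⟨n, h⟩ else t (n - r.length)

/-- Membership in Thompson's group `V`. -/
def inV (g : Homeomorph CantorSpace CantorSpace) : Prop :=
  ∃ (m : ℕ) (r s : Fin m → List Bool),
    (∀ x : CantorSpace, ∃! i : Fin m, x ∈ cylinder (r i)) ∧
    (∀ x : CantorSpace, ∃! i : Fin m, x ∈ cylinder (s i)) ∧
    ∀ (i : Fin m) (t : CantorSpace), g (wordConcat (r i) t) = wordConcat (s i) t

/-- Near a fixed point `z`, an element of `V` replaces the prefix of `z` of length `a`
by the prefix of `z` of length `b`. -/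
theorem inV_local (g : Homeomorph CantorSpace CantorSpace) (hg : inV g)
    (z : CantorSpace) (hgz : g z = z) :
    ∃ a b : ℕ, ∀ u : CantorSpace, (∀ n < a, u n = z n) →
      (∀ n < b, g u n = z n) ∧ ∀ n, b ≤ n → g u n = u (n - b + a) := by
  obtain ⟨m, r, s, hr, -, hgs⟩ := hg
  obtain ⟨i, hi, -⟩ := hr z
  have key : ∀ u : CantorSpace, (∀ n < (r i).length, u n = z n) →
      g u = wordConcat (s i) (fun n => u (n + (r i).length)) := by
    intro u hu
    rw [← hgs i]
    congr 1
    funext n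
    unfold wordConcat
    split_ifs with h
    · rw [hu n h]; exact hi ⟨n, h⟩
    · congr 1; omega
  refine ⟨(r i).length, (s i).length, fun u hu => ⟨fun n hn => ?_, fun n hn => ?_⟩⟩
  · have hz := congrFun (key z fun _ _ => rfl) n
    rw [hgz] at hz
    rw [hz, key u hu]
    simp [wordConcat, hn]
  · rw [key u hu]
    simp [wordConcat, Nat.not_lt.mpr hn]

theorem thompsonV_commutator_fixes_nbhd
    (g h : Homeomorph CantorSpace CantorSpace) (hg : inV g) (hh : inV h)
    (z : CantorSpace) (hgz : g z = z) (hhz : h z = z) :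
    ∃ U : Set CantorSpace, IsOpen U ∧ z ∈ U ∧
      ∀ u ∈ U, g.symm (h.symm (g (h u))) = u := by
  obtain ⟨a, b, hG⟩ := inV_local g hg z hgz
  obtain ⟨c, d, hH⟩ := inV_local h hh z hhz
  have zg := (hG z fun _ _ => rfl).2
  have zh := (hH z fun _ _ => rfl).2
  rw [hgz] at zg
  rw [hhz] at zh
  refine ⟨{u | ∀ n ∈ Set.Iio (a + c), u n = z n}, ?_, fun _ _ => rfl, fun u hu => ?_⟩
  · have : {u : CantorSpace | ∀ n ∈ Set.Iio (a + c), u n = z n}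
        = Set.pi (Set.Iio (a + c)) fun n => {z n} := by
      ext u; simp [Set.mem_pi]
    rw [this]
    exact isOpen_set_pi (Set.finite_Iio _) fun _ _ => isOpen_discrete _
  · have hu : ∀ n < a + c, u n = z n := hu
    rw [Homeomorph.symm_apply_eq, Homeomorph.symm_apply_eq]
    obtain ⟨g1, g2⟩ := hG u fun n hn => hu n (by omega)
    obtain ⟨h1, h2⟩ := hH u fun n hn => hu n (by omega)
    obtain ⟨gh1, gh2⟩ := hG (h u) fun n hn => by
      by_cases hd : n < d
      · exact h1 n hd
      · rw [h2 n (by omega), hu _ (by omega), ← zh n (by omega)]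
    obtain ⟨hg1, hg2⟩ := hH (g u) fun n hn => by
      by_cases hd : n < b
      · exact g1 n hd
      · rw [g2 n (by omega), hu _ (by omega), ← zg n (by omega)]
    -- both composites are `z n` for `n < b + d` and the common shift of `u` afterwards
    have A : ∀ n, n < b + d → g (h u) n = z n := by
      intro n hn
      by_cases hb : n < b
      · exact gh1 n hb
      · rw [gh2 n (by omega), zg n (by omega)]
        by_cases hd : n - b + a < d
        · exact h1 _ hd
        · rw [h2 _ (by omega), hu _ (by omega), ← zh _ (by omega)]
    have B : ∀ n, n < b + d → h (g u) n = z n := by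
      intro n hn
      by_cases hb : n < d
      · exact hg1 n hb
      · rw [hg2 n (by omega), zh n (by omega)]
        by_cases hd : n - d + c < b
        · exact g1 _ hd
        · rw [g2 _ (by omega), hu _ (by omega), ← zg _ (by omega)]
    funext n
    by_cases hn : n < b + d
    · rw [A n hn, B n hn]
    · rw [gh2 n (by omega), hg2 n (by omega)]
      by_cases h3 : n - b + a < d
      · omega
      by_cases h4 : n - d + c < b
      · omega
      rw [h2 _ (by omega), g2 _ (by omega)]
      congr 1
      omega
end
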